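/- Let s ∈ [0,1], let f and g be Lipschitz functions in B₁ ⊂ ℝ^n, and let u ∈ C^∞(ℝ^n) ∩ W^{2,∞}(ℝ^n) be a solution of max{ (-Δ)^s u, u − g } = f everywhere in B₁. Then sup_{B_{1/2}} |∇u| ≤ C( ‖u‖_{L^∞(ℝ^n)} + ‖∇f‖_{L^∞(B₁)} + ‖∇g‖_{L^∞(B₁)} ) for some constant C depending only on n. If, in addition, f and g are semiconcave in B₁, then for every e ∈ ℝ^n with |e| = 1, sup_{B_{1/2}} ∂²_e u ≤ C( ‖u‖_{L^∞(ℝ^n)} + ‖∂_e f‖_{L^∞(B₁)} + ‖(∂²_e f)₊‖_{L^∞(B₁)} + ‖∂_e g‖_{L^∞(B₁)} + ‖(∂²_e g)₊‖_{L^∞(B₁)} ), with C as before. -/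

import Mathlib

open MeasureTheory Filter Metric Set

noncomputable section

/-- Euclidean space `ℝⁿ`. -/
abbrev En (n : ℕ) := EuclideanSpace ℝ (Fin n)

/-- Principal value integral centered at `x`: the limit, as `ε → 0⁺`, of the integrals
over the complement of the `ε`-ball centered at `x`. -/
def pvAt (n : ℕ) (x : En n) (g : En n → ℝ) : ℝ :=
  limUnder (nhdsWithin (0:ℝ) (Set.Ioi 0))
    (fun ε => ∫ y in {y : En n | ε ≤ dist y x}, g y)

/-- Integro-differential operator with kernel `K`:
`𝓛_K u (x) = P.V. ∫ (u x - u y) K (x - y) dy`. -/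
def opK (n : ℕ) (K : En n → ℝ) (u : En n → ℝ) (x : En n) : ℝ :=
  pvAt n x (fun y => (u x - u y) * K (x - y))

/-- The normalizing constant `c_{n,s}` of the fractional Laplacian, for which the
Fourier symbol is `|ξ|^{2s}`. -/
def cns (n : ℕ) (s : ℝ) : ℝ :=
  (4:ℝ) ^ s * s * Real.Gamma ((n:ℝ)/2 + s) / (Real.pi ^ ((n:ℝ)/2) * Real.Gamma (1 - s))

/-- The fractional Laplacian `(-Δ)^s`, for `s ∈ (0,1)`. -/
def fracLap (n : ℕ) (s : ℝ) (u : En n → ℝ) (x : En n) : ℝ :=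
  opK n (fun z => cns n s * ‖z‖ ^ (-((n:ℝ) + 2*s))) u x

/-- Directional derivative `∂_e u`. -/
def dd (n : ℕ) (e : En n) (u : En n → ℝ) (x : En n) : ℝ := fderiv ℝ u x e

/-- Second directional derivative `∂²_e u`. -/
def dd2 (n : ℕ) (e : En n) (u : En n → ℝ) (x : En n) : ℝ := fderiv ℝ (dd n e u) x e

/-- `‖η‖_{C²(ℝⁿ)} ≤ M`. -/
def C2BddBy (n : ℕ) (η : En n → ℝ) (M : ℝ) : Prop :=
  ∀ x : En n, |η x| ≤ M ∧ ‖fderiv ℝ η x‖ ≤ M ∧ ‖fderiv ℝ (fderiv ℝ η) x‖ ≤ M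

/-- The kernel `K` is even and has two-sided power bounds with constants `C₁ ≤ C₂`:
`K(z) = K(-z)` and `C₁ s(1-s)|z|^{-n-2s} ≤ K(z) ≤ C₂ s(1-s)|z|^{-n-2s}` for `z ≠ 0`. -/
def evenPowKernel (n : ℕ) (s C₁ C₂ : ℝ) (K : En n → ℝ) : Prop :=
  (∀ z : En n, z ≠ 0 → K z = K (-z)) ∧
  (∀ z : En n, z ≠ 0 →
    C₁ * (s * (1 - s)) * ‖z‖ ^ (-((n:ℝ) + 2*s)) ≤ K z ∧
    K z ≤ C₂ * (s * (1 - s)) * ‖z‖ ^ (-((n:ℝ) + 2*s)))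

/-- `K ∈ C²(ℝⁿ \ {0})` with `|z||∇K(z)| + |z|²|D²K(z)| ≤ C₃ K(z)` for `z ≠ 0`. -/
def kernelDerivBdd (n : ℕ) (C₃ : ℝ) (K : En n → ℝ) : Prop :=
  ContDiffOn ℝ 2 K {z : En n | z ≠ 0} ∧
  ∀ z : En n, z ≠ 0 →
    ‖z‖ * ‖fderiv ℝ K z‖ + ‖z‖^2 * ‖fderiv ℝ (fderiv ℝ K) z‖ ≤ C₃ * K z

/-- `(-Δ) u (x)` computed through the liminf of second incremental quotients
(which equals `-Δu(x)` whenever `u` is `C²` near `x`). -/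
def negLapInc (n : ℕ) (u : En n → ℝ) (x : En n) : ℝ :=
  Filter.liminf (fun h : ℝ =>
      ∑ i : Fin n, (2 * u x - u (x + h • EuclideanSpace.single i 1)
        - u (x - h • EuclideanSpace.single i 1)) / h ^ 2)
    (nhdsWithin (0:ℝ) (Set.Ioi 0))

/-- The fractional Laplacian `(-Δ)^s` for `s ∈ [0,1]`, with the conventions
`(-Δ)^0 = Id` and `(-Δ)^1 = -Δ` (the latter via second incremental quotients). -/
def fracLapE (n : ℕ) (s : ℝ) (u : En n → ℝ) (x : En n) : ℝ :=
  if s = 0 then u x else if s = 1 then negLapInc n u x else fracLap n s u x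

/-- The operator `𝓛_μ u (x) = ∫₀¹ (-Δ)^s u (x) dμ(s)` for a measure `μ` on `[0,1]`. -/
def opMu (n : ℕ) (μ : Measure ℝ) (u : En n → ℝ) (x : En n) : ℝ :=
  ∫ s, fracLapE n s u x ∂μ

/-- The surface measure of the unit sphere of `ℝⁿ`. -/
def sphereMass (n : ℕ) : ℝ := n * volume.real (ball (0 : En n) 1)

lemma sphereMass_pos {n : ℕ} (hn : 0 < n) : 0 < sphereMass n := by
  have : 0 < volume.real (ball (0 : En n) 1) :=
    ENNReal.toReal_pos (measure_ball_pos volume _ one_pos).ne' measure_ball_lt_top.ne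
  unfold sphereMass
  positivity

lemma integrableOn_norm_preimage_iff {n : ℕ} (hn : 0 < n) (F : ℝ → ℝ) {A : Set ℝ}
    (hA : MeasurableSet A) (hA0 : A ⊆ Ioi 0) :
    IntegrableOn (fun z : En n => F ‖z‖) {z | ‖z‖ ∈ A} ↔
      IntegrableOn (fun y : ℝ => y ^ (n - 1) * F y) A := by
  have : Nonempty (Fin n) := ⟨⟨0, hn⟩⟩
  have hm : MeasurableSet {z : En n | ‖z‖ ∈ A} := measurable_norm hA
  have h := integrable_fun_norm_addHaar (volume : Measure (En n)) (f := A.indicator F)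
  rw [finrank_euclideanSpace_fin] at h
  have e1 : (fun z : En n => A.indicator F ‖z‖) =
      {z : En n | ‖z‖ ∈ A}.indicator (fun z => F ‖z‖) := by
    ext z; simp [indicator]
  have e2 : (fun y : ℝ => y ^ (n - 1) • A.indicator F y) =
      A.indicator (fun y => y ^ (n - 1) * F y) := by
    ext z; simp [indicator]
  rw [e1, e2, integrable_indicator_iff hm, integrableOn_indicator_iff hA,
    inter_eq_left.2 hA0] at h
  exact h

lemma setIntegral_norm_preimage {n : ℕ} (hn : 0 < n) (F : ℝ → ℝ) {A : Set ℝ}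
    (hA : MeasurableSet A) (hA0 : A ⊆ Ioi 0) :
    ∫ z in {z : En n | ‖z‖ ∈ A}, F ‖z‖ = sphereMass n * ∫ y in A, y ^ (n - 1) * F y := by
  have : Nonempty (Fin n) := ⟨⟨0, hn⟩⟩
  have hm : MeasurableSet {z : En n | ‖z‖ ∈ A} := measurable_norm hA
  have h := integral_fun_norm_addHaar (volume : Measure (En n)) (A.indicator F)
  rw [finrank_euclideanSpace_fin] at h
  have e1 : (fun z : En n => A.indicator F ‖z‖) =
      {z : En n | ‖z‖ ∈ A}.indicator (fun z => F ‖z‖) := by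
    ext z; simp [indicator]
  have e2 : (fun y : ℝ => y ^ (n - 1) • A.indicator F y) =
      A.indicator (fun y => y ^ (n - 1) * F y) := by
    ext z; simp [indicator]
  rw [e1, e2, integral_indicator hm, setIntegral_indicator hA, inter_eq_right.2 hA0] at h
  rw [h, sphereMass]
  simp [mul_assoc]

lemma pow_mul_rpow_of_pos {n : ℕ} (hn : 0 < n) {y : ℝ} (hy : 0 < y) (b : ℝ) :
    y ^ (n - 1) * y ^ (b - n) = y ^ (b - 1) := by
  rw [← Real.rpow_natCast, ← Real.rpow_add hy]
  congr 1
  push_cast [Nat.cast_sub hn]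
  ring

lemma integrableOn_shell {n : ℕ} (hn : 0 < n) {b τ ρ : ℝ} (hb : 0 < b) (hτ : 0 ≤ τ) :
    IntegrableOn (fun z : En n => ‖z‖ ^ (b - n)) {z | ‖z‖ ∈ Ioc τ ρ} := by
  have hsub : Ioc τ ρ ⊆ Ioi 0 := fun y hy => hτ.trans_lt hy.1
  rw [integrableOn_norm_preimage_iff hn (fun y => y ^ (b - n)) measurableSet_Ioc hsub]
  refine IntegrableOn.congr_fun (f := fun y => y ^ (b - 1)) ?_
    (fun y hy => (pow_mul_rpow_of_pos hn (hsub hy) b).symm) measurableSet_Ioc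
  rcases le_total τ ρ with h | h
  · exact (intervalIntegrable_iff_integrableOn_Ioc_of_le h).1
      (intervalIntegral.intervalIntegrable_rpow' (by linarith))
  · simp [Ioc_eq_empty (not_lt.2 h)]

lemma setIntegral_shell {n : ℕ} (hn : 0 < n) {b τ ρ : ℝ} (hb : 0 < b) (hτ : 0 ≤ τ)
    (hρ : τ ≤ ρ) :
    ∫ z in {z : En n | ‖z‖ ∈ Ioc τ ρ}, ‖z‖ ^ (b - n) =
      sphereMass n * ((ρ ^ b - τ ^ b) / b) := by
  have hsub : Ioc τ ρ ⊆ Ioi 0 := fun y hy => hτ.trans_lt hy.1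
  rw [setIntegral_norm_preimage hn (fun y => y ^ (b - n)) measurableSet_Ioc hsub,
    setIntegral_congr_fun measurableSet_Ioc
      (fun y hy => pow_mul_rpow_of_pos hn (hsub hy) b),
    ← intervalIntegral.integral_of_le hρ, integral_rpow (Or.inl (by linarith))]
  simp

lemma integrableOn_exterior {n : ℕ} (hn : 0 < n) {b : ℝ} (hb : b < 0) :
    IntegrableOn (fun z : En n => ‖z‖ ^ (b - n)) {z | ‖z‖ ∈ Ioi 1} := by
  have hsub : Ioi (1 : ℝ) ⊆ Ioi 0 := Ioi_subset_Ioi zero_le_one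
  rw [integrableOn_norm_preimage_iff hn (fun y => y ^ (b - n)) measurableSet_Ioi hsub]
  exact IntegrableOn.congr_fun (integrableOn_Ioi_rpow_of_lt (a := b - 1) (by linarith) one_pos)
    (fun y hy => (pow_mul_rpow_of_pos hn (hsub hy) b).symm) measurableSet_Ioi

lemma setIntegral_exterior {n : ℕ} (hn : 0 < n) {b : ℝ} (hb : b < 0) :
    ∫ z in {z : En n | ‖z‖ ∈ Ioi 1}, ‖z‖ ^ (b - n) = sphereMass n * (1 / -b) := by
  have hsub : Ioi (1 : ℝ) ⊆ Ioi 0 := Ioi_subset_Ioi zero_le_one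
  rw [setIntegral_norm_preimage hn (fun y => y ^ (b - n)) measurableSet_Ioi hsub,
    setIntegral_congr_fun measurableSet_Ioi
      (fun y hy => pow_mul_rpow_of_pos hn (hsub hy) b),
    integral_Ioi_rpow_of_lt (by linarith) one_pos]
  simp [div_neg, neg_div]

lemma exists_cns_bounds {n : ℕ} (hn : 0 < n) :
    ∃ a A : ℝ, 0 < a ∧ 0 < A ∧ ∀ s ∈ Ioo (0 : ℝ) 1,
      a * (s * (1 - s)) ≤ cns n s ∧ cns n s ≤ A * (s * (1 - s)) := by
  set G : ℝ → ℝ := fun s => (4:ℝ) ^ s * Real.Gamma ((n:ℝ)/2 + s) /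
    (Real.pi ^ ((n:ℝ)/2) * Real.Gamma (2 - s)) with hG
  have hn' : (0 : ℝ) < n := by exact_mod_cast hn
  have hpos : ∀ s ∈ Icc (0 : ℝ) 1, 0 < G s := by
    intro s hs
    have h1 : 0 < Real.Gamma ((n:ℝ)/2 + s) := Real.Gamma_pos_of_pos (by have := hs.1; positivity)
    have h2 : 0 < Real.Gamma (2 - s) := Real.Gamma_pos_of_pos (by linarith [hs.2])
    have := Real.pi_pos
    simp only [hG]
    positivity
  have hcont : ContinuousOn G (Icc 0 1) := by
    intro s hs
    have h2 : 0 < Real.Gamma (2 - s) := Real.Gamma_pos_of_pos (by linarith [hs.2])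
    have d : ∀ x : ℝ, 0 < x → ContinuousAt Real.Gamma x := fun x hx =>
      (Real.differentiableAt_Gamma fun m => by
        have := m.cast_nonneg (α := ℝ)
        linarith).continuousAt
    refine ContinuousAt.continuousWithinAt ?_
    refine ContinuousAt.div (ContinuousAt.mul ?_ ?_) (ContinuousAt.mul continuousAt_const ?_) ?_
    · exact (Real.continuous_const_rpow (by norm_num)).continuousAt
    · exact ContinuousAt.comp (f := fun s : ℝ => (n:ℝ)/2 + s)
        (d _ (by have := hs.1; positivity)) (by fun_prop)
    · exact ContinuousAt.comp (f := fun s : ℝ => 2 - s)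
        (d _ (by linarith [hs.2])) (by fun_prop)
    · have := Real.pi_pos
      positivity
  obtain ⟨x, hx, hmin⟩ := isCompact_Icc.exists_isMinOn ⟨0, by simp⟩ hcont
  obtain ⟨y, hy, hmax⟩ := isCompact_Icc.exists_isMaxOn ⟨0, by simp⟩ hcont
  refine ⟨G x, G y, hpos x hx, hpos y hy, fun s hs => ?_⟩
  have hs' : s ∈ Icc (0 : ℝ) 1 := ⟨hs.1.le, hs.2.le⟩
  have h1s : 0 < 1 - s := by linarith [hs.2]
  have hval : cns n s = G s * (s * (1 - s)) := by
    have hg : Real.Gamma (2 - s) = (1 - s) * Real.Gamma (1 - s) := by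
      rw [← Real.Gamma_add_one h1s.ne']; congr 1; ring
    have h3 := (Real.Gamma_pos_of_pos h1s).ne'
    have h4 : Real.pi ^ ((n:ℝ)/2) ≠ 0 := (Real.rpow_pos_of_pos Real.pi_pos _).ne'
    simp only [hG, cns, hg]
    field_simp
  have h0 : 0 ≤ s * (1 - s) := mul_nonneg hs.1.le h1s.le
  rw [hval]
  exact ⟨mul_le_mul_of_nonneg_right (hmin hs') h0, mul_le_mul_of_nonneg_right (hmax hs') h0⟩

lemma cns_pos {n : ℕ} (hn : 0 < n) {s : ℝ} (hs : s ∈ Ioo (0 : ℝ) 1) : 0 < cns n s := by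
  obtain ⟨a, A, ha, -, h⟩ := exists_cns_bounds hn
  have : 0 < s * (1 - s) := mul_pos hs.1 (by linarith [hs.2])
  exact (mul_pos ha this).trans_le (h s hs).1

/-- The homogeneous kernel `|z|^{-n-2s}` of the fractional Laplacian. -/
def fracKernel (n : ℕ) (s : ℝ) (z : En n) : ℝ := ‖z‖ ^ (-((n:ℝ) + 2*s))

/-- A regularization of `|z|²` which is positive at the origin and agrees with `|z|²` outside the
unit ball. -/
def regSq (n : ℕ) (z : En n) : ℝ := ‖z‖ ^ 2 + (max (1 - ‖z‖ ^ 2) 0) ^ 3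

/-- A regular kernel which agrees with `fracKernel` outside the unit ball. -/
def tailKernel (n : ℕ) (s : ℝ) (z : En n) : ℝ := regSq n z ^ (-((n:ℝ)/2 + s))

/-- The singular part of `fracKernel`, supported in the unit ball. -/
def localKernel (n : ℕ) (s : ℝ) (z : En n) : ℝ := fracKernel n s z - tailKernel n s z

section kernels
variable {n : ℕ} {s : ℝ}

lemma half_le_regSq (z : En n) : 1 / 2 ≤ regSq n z := by
  unfold regSq
  have h1 := le_max_left (1 - ‖z‖ ^ 2) 0
  have h2 := le_max_right (1 - ‖z‖ ^ 2) 0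
  set m := max (1 - ‖z‖ ^ 2) 0
  nlinarith [mul_nonneg (by linarith : (0:ℝ) ≤ m + 1.16) (sq_nonneg (m - 0.58))]

lemma regSq_pos (z : En n) : 0 < regSq n z := by linarith [half_le_regSq z]

lemma sq_le_regSq (z : En n) : ‖z‖ ^ 2 ≤ regSq n z := by
  unfold regSq
  have h2 := le_max_right (1 - ‖z‖ ^ 2) 0
  have : 0 ≤ (max (1 - ‖z‖ ^ 2) 0) ^ 3 := by positivity
  linarith

lemma regSq_of_one_le {z : En n} (hz : 1 ≤ ‖z‖) : regSq n z = ‖z‖ ^ 2 := by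
  unfold regSq
  rw [max_eq_right (by nlinarith)]
  simp

lemma two_mul_sq_le_regSq {z : En n} (hz : ‖z‖ ≤ 1 / 2) : 2 * ‖z‖ ^ 2 ≤ regSq n z := by
  unfold regSq
  have h0 := norm_nonneg z
  have h1 : ‖z‖ ^ 2 ≤ 1 / 4 := by nlinarith
  have h2 : (3 / 4 : ℝ) ≤ max (1 - ‖z‖ ^ 2) 0 := le_max_of_le_left (by linarith)
  have h3 := pow_le_pow_left₀ (by norm_num) h2 3
  linarith

lemma fracKernel_nonneg (z : En n) : 0 ≤ fracKernel n s z := by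
  unfold fracKernel; positivity

lemma fracKernel_eq {z : En n} (hz : z ≠ 0) :
    fracKernel n s z = (‖z‖ ^ 2) ^ (-((n:ℝ)/2 + s)) := by
  have := norm_pos_iff.2 hz
  rw [fracKernel, ← Real.rpow_natCast, ← Real.rpow_mul this.le]
  congr 1
  push_cast
  ring

lemma fracKernel_neg (z : En n) : fracKernel n s (-z) = fracKernel n s z := by simp [fracKernel]

lemma tailKernel_neg (z : En n) : tailKernel n s (-z) = tailKernel n s z := by
  simp [tailKernel, regSq]

lemma tailKernel_pos (z : En n) : 0 < tailKernel n s z := Real.rpow_pos_of_pos (regSq_pos z) _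

lemma continuous_regSq : Continuous (regSq n) := by unfold regSq; fun_prop

lemma continuous_tailKernel : Continuous (tailKernel n s) :=
  continuous_regSq.rpow_const fun z => Or.inl (regSq_pos z).ne'

lemma measurable_fracKernel : Measurable (fracKernel n s) := by
  unfold fracKernel; fun_prop

lemma measurable_localKernel : Measurable (localKernel n s) :=
  measurable_fracKernel.sub continuous_tailKernel.measurable

lemma tailKernel_of_one_le {z : En n} (hz : 1 ≤ ‖z‖) : tailKernel n s z = fracKernel n s z := by
  rw [fracKernel_eq (norm_pos_iff.1 (one_pos.trans_le hz)), tailKernel, regSq_of_one_le hz]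

lemma tailKernel_le (hs : 0 < s) {z : En n} (hz : z ≠ 0) :
    tailKernel n s z ≤ fracKernel n s z := by
  rw [fracKernel_eq hz]
  have := norm_pos_iff.2 hz
  exact Real.rpow_le_rpow_of_nonpos (by positivity) (sq_le_regSq z)
    (by have : (0:ℝ) ≤ n := n.cast_nonneg
        linarith)

lemma tailKernel_le_two_rpow (hs : 0 < s) (z : En n) :
    tailKernel n s z ≤ 2 ^ ((n:ℝ)/2 + s) := by
  have : (0:ℝ) ≤ n := n.cast_nonneg
  refine (Real.rpow_le_rpow_of_nonpos (by norm_num) (half_le_regSq z) (by linarith)).trans ?_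
  rw [Real.rpow_neg (by norm_num), ← Real.inv_rpow (by norm_num)]
  norm_num

lemma localKernel_of_one_le {z : En n} (hz : 1 ≤ ‖z‖) : localKernel n s z = 0 := by
  rw [localKernel, tailKernel_of_one_le hz, sub_self]

lemma localKernel_nonneg (hs : 0 < s) {z : En n} (hz : z ≠ 0) : 0 ≤ localKernel n s z :=
  sub_nonneg.2 (tailKernel_le hs hz)

lemma localKernel_le (z : En n) : localKernel n s z ≤ fracKernel n s z :=
  sub_le_self _ (tailKernel_pos z).le

lemma quarter_fracKernel_le_localKernel (hn : 0 < n) (hs : 0 < s) {z : En n} (hz : z ≠ 0)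
    (hz2 : ‖z‖ ≤ 1 / 2) : fracKernel n s z / 4 ≤ localKernel n s z := by
  have hn' : (1:ℝ) ≤ n := by exact_mod_cast hn
  have hpos := norm_pos_iff.2 hz
  have h1 : tailKernel n s z ≤ (2 * ‖z‖ ^ 2) ^ (-((n:ℝ)/2 + s)) :=
    Real.rpow_le_rpow_of_nonpos (by positivity) (two_mul_sq_le_regSq hz2) (by linarith)
  rw [Real.mul_rpow (by norm_num) (by positivity), ← fracKernel_eq hz] at h1
  have h2 : (2:ℝ) ^ (-((n:ℝ)/2 + s)) ≤ 2 ^ (-(1/2) : ℝ) :=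
    Real.rpow_le_rpow_of_exponent_le (by norm_num) (by linarith)
  have h3 : (2:ℝ) ^ (-(1/2) : ℝ) ≤ 3 / 4 := by
    rw [Real.rpow_neg (by norm_num), ← Real.sqrt_eq_rpow]
    rw [inv_le_comm₀ (by positivity) (by norm_num)]
    exact Real.le_sqrt_of_sq_le (by norm_num)
  have h4 := mul_le_mul_of_nonneg_right (h2.trans h3) (fracKernel_nonneg (s := s) z)
  unfold localKernel
  linarith

lemma integrable_tailKernel (hn : 0 < n) (hs : 0 < s) : Integrable (tailKernel n s) := by
  rw [← integrableOn_univ, show (univ : Set (En n)) = closedBall 0 1 ∪ {z | ‖z‖ ∈ Ioi 1} by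
    ext z; simp [le_or_gt]]
  refine IntegrableOn.union ?_ ?_
  · exact continuous_tailKernel.continuousOn.integrableOn_compact (isCompact_closedBall _ _)
  · refine (integrableOn_exterior hn (b := -(2*s)) (by linarith)).congr_fun (fun z hz => ?_)
      (measurable_norm measurableSet_Ioi)
    rw [tailKernel_of_one_le (le_of_lt hz), fracKernel]
    dsimp only
    congr 1
    ring

lemma setIntegral_tailKernel_exterior (hn : 0 < n) (hs : 0 < s) :
    ∫ z in {z : En n | ‖z‖ ∈ Ioi 1}, tailKernel n s z = sphereMass n * (1 / (2 * s)) := by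
  have h := setIntegral_exterior hn (b := -(2*s)) (by linarith)
  rw [neg_neg] at h
  rw [← h]
  refine setIntegral_congr_fun (measurable_norm measurableSet_Ioi) (fun z hz => ?_)
  rw [tailKernel_of_one_le (le_of_lt hz), fracKernel]
  congr 1
  ring

lemma le_integral_tailKernel (hn : 0 < n) (hs : 0 < s) :
    sphereMass n * (1 / (2 * s)) ≤ ∫ z, tailKernel n s z := by
  rw [← setIntegral_tailKernel_exterior hn hs]
  exact setIntegral_le_integral (integrable_tailKernel hn hs)
    (ae_of_all _ fun z => (tailKernel_pos z).le)

lemma integral_tailKernel_le (hn : 0 < n) (hs : s ∈ Ioo (0:ℝ) 1) :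
    ∫ z, tailKernel n s z ≤
      2 ^ ((n:ℝ)/2 + 1) * volume.real (closedBall (0 : En n) 1) + sphereMass n * (1 / (2 * s)) := by
  have hd : Disjoint (closedBall (0 : En n) 1) {z | ‖z‖ ∈ Ioi 1} :=
    Set.disjoint_left.2 fun z h1 h2 => by
      simp at h1 h2; linarith
  have hint := integrable_tailKernel hn hs.1
  rw [← setIntegral_univ, show (univ : Set (En n)) = closedBall 0 1 ∪ {z | ‖z‖ ∈ Ioi 1} by
    ext z; simp [le_or_gt], setIntegral_union hd (measurable_norm measurableSet_Ioi)
    hint.integrableOn hint.integrableOn, setIntegral_tailKernel_exterior hn hs.1]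
  gcongr
  have h2 := norm_setIntegral_le_of_norm_le_const (μ := volume) (s := closedBall (0 : En n) 1)
    (f := tailKernel n s) (C := 2 ^ ((n:ℝ)/2 + 1)) (measure_closedBall_lt_top) (fun z _ => by
      rw [Real.norm_of_nonneg (tailKernel_pos z).le]
      refine (tailKernel_le_two_rpow hs.1 z).trans ?_
      exact Real.rpow_le_rpow_of_exponent_le (by norm_num) (by linarith [hs.2]))
  exact (le_abs_self _).trans h2

lemma exists_cns_mul_integral_tailKernel_le (hn : 0 < n) :
    ∃ C : ℝ, 0 < C ∧ ∀ s ∈ Ioo (0:ℝ) 1, cns n s * ∫ z, tailKernel n s z ≤ C := by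
  obtain ⟨a, A, -, hA, h⟩ := exists_cns_bounds hn
  set V := 2 ^ ((n:ℝ)/2 + 1) * volume.real (closedBall (0 : En n) 1)
  have hV : 0 ≤ V := by positivity
  have hω := sphereMass_pos hn
  refine ⟨A * (V + sphereMass n), by positivity, fun s hs => ?_⟩
  have hc := cns_pos hn hs
  have h1 := mul_le_mul_of_nonneg_left (integral_tailKernel_le hn hs) hc.le
  have hs0 := hs.1
  have hs1 := hs.2
  have h2 : cns n s ≤ A * s := (h s hs).2.trans (by nlinarith [mul_pos hA hs0])
  refine h1.trans ((mul_le_mul_of_nonneg_right h2 (by positivity)).trans ?_)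
  have e : A * s * (V + sphereMass n * (1 / (2 * s))) = A * (s * V + sphereMass n / 2) := by
    field_simp
  rw [e]
  refine mul_le_mul_of_nonneg_left ?_ hA.le
  nlinarith

lemma exists_le_cns_mul_integral_tailKernel (hn : 0 < n) :
    ∃ c : ℝ, 0 < c ∧ ∀ s ∈ Ioo (0:ℝ) 1, s ≤ 1 / 2 → c ≤ cns n s * ∫ z, tailKernel n s z := by
  obtain ⟨a, A, ha, -, h⟩ := exists_cns_bounds hn
  have hω := sphereMass_pos hn
  refine ⟨a * sphereMass n / 4, by positivity, fun s hs hs2 => ?_⟩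
  have hc := cns_pos hn hs
  have hs0 := hs.1
  have h1 := mul_le_mul_of_nonneg_left (le_integral_tailKernel hn hs.1) hc.le
  have h2 : a * (s / 2) ≤ cns n s := le_trans (by gcongr; nlinarith) (h s hs).1
  refine le_trans ?_ ((mul_le_mul_of_nonneg_right h2 (by positivity)).trans h1)
  apply le_of_eq
  field_simp
  norm_num

lemma hasDerivAt_max_zero_pow (k : ℕ) (x : ℝ) :
    HasDerivAt (fun x : ℝ => max x 0 ^ (k + 2)) ((k + 2) * max x 0 ^ (k + 1)) x := by
  rcases lt_trichotomy x 0 with hx | rfl | hx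
  · have : (fun x : ℝ => max x 0 ^ (k + 2)) =ᶠ[nhds x] fun _ => 0 := by
      filter_upwards [gt_mem_nhds hx] with y hy
      simp [max_eq_right hy.le]
    simpa [max_eq_right hx.le] using (hasDerivAt_const x (0:ℝ)).congr_of_eventuallyEq this
  · have h : (fun x : ℝ => max x 0 ^ (k + 2)) =O[nhds 0] fun x => ‖x - 0‖ ^ (k + 2) := by
      refine Asymptotics.IsBigO.of_bound 1 (Eventually.of_forall fun y => ?_)
      have : |max y 0| ≤ |y| := by
        rcases le_total y 0 with h | h
        · simp [max_eq_right h]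
        · simp [max_eq_left h]
      simpa using pow_le_pow_left₀ (abs_nonneg _) this (k + 2)
    simpa using (h.hasFDerivAt (by omega)).hasDerivAt
  · have : (fun x : ℝ => max x 0 ^ (k + 2)) =ᶠ[nhds x] fun x => x ^ (k + 2) := by
      filter_upwards [lt_mem_nhds hx] with y hy
      simp [max_eq_left hy.le]
    simpa [max_eq_left hx.le] using (hasDerivAt_pow (k + 2) x).congr_of_eventuallyEq this

/-- The derivative of `regSq` in the direction `e`. -/
def regSqD (n : ℕ) (e z : En n) : ℝ :=
  2 * inner ℝ z e * (1 - 3 * (max (1 - ‖z‖ ^ 2) 0) ^ 2)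

/-- The second derivative of `regSq` in the direction `e`. -/
def regSqDD (n : ℕ) (e z : En n) : ℝ :=
  2 * ‖e‖ ^ 2 * (1 - 3 * (max (1 - ‖z‖ ^ 2) 0) ^ 2)
    + 24 * (inner ℝ z e) ^ 2 * max (1 - ‖z‖ ^ 2) 0

lemma hasDerivAt_norm_sq_line (z e : En n) :
    HasDerivAt (fun t : ℝ => ‖z + t • e‖ ^ 2) (2 * inner ℝ z e) 0 := by
  have h : HasDerivAt (fun t : ℝ => z + t • e) e 0 := by
    simpa using ((hasDerivAt_id (0:ℝ)).smul_const e).const_add z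
  simpa using h.norm_sq

lemma hasLineDerivAt_regSq (z e : En n) :
    HasLineDerivAt ℝ (regSq n) (regSqD n e z) z e := by
  have h := hasDerivAt_norm_sq_line z e
  have h2 := (hasDerivAt_max_zero_pow 1 (1 - ‖z + (0:ℝ) • e‖ ^ 2)).comp 0 (h.const_sub 1)
  have h3 := h.add h2
  unfold HasLineDerivAt
  refine (h3.congr_deriv ?_).congr_of_eventuallyEq (Eventually.of_forall fun t => ?_)
  · simp [regSqD]; ring
  · simp [regSq]

lemma hasLineDerivAt_regSqD (z e : En n) :
    HasLineDerivAt ℝ (regSqD n e) (regSqDD n e z) z e := by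
  have h := hasDerivAt_norm_sq_line z e
  have h2 := (hasDerivAt_max_zero_pow 0 (1 - ‖z + (0:ℝ) • e‖ ^ 2)).comp 0 (h.const_sub 1)
  have h1 : HasDerivAt (fun t : ℝ => inner ℝ (z + t • e) e) (‖e‖ ^ 2) 0 := by
    have h : HasDerivAt (fun t : ℝ => z + t • e) e 0 := by
      simpa using ((hasDerivAt_id (0:ℝ)).smul_const e).const_add z
    simpa using h.inner ℝ (hasDerivAt_const (0:ℝ) e)
  have h3 := (h1.const_mul 2).mul ((h2.const_mul 3).const_sub 1)
  unfold HasLineDerivAt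
  refine (h3.congr_deriv ?_).congr_of_eventuallyEq (Eventually.of_forall fun t => ?_)
  · simp [regSqDD]; ring
  · simp [regSqD]

lemma max_one_sub_sq_mem (z : En n) : max (1 - ‖z‖ ^ 2) 0 ∈ Icc (0:ℝ) 1 :=
  ⟨le_max_right _ _, max_le (by nlinarith [norm_nonneg z]) zero_le_one⟩

lemma abs_inner_le_norm_of_unit {e : En n} (he : ‖e‖ = 1) (z : En n) :
    |inner ℝ z e| ≤ ‖z‖ := by simpa [he] using abs_real_inner_le_norm z e

lemma abs_regSqD_le {e : En n} (he : ‖e‖ = 1) (z : En n) : |regSqD n e z| ≤ 4 * ‖z‖ := by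
  have hm := max_one_sub_sq_mem z
  have hi := abs_inner_le_norm_of_unit he z
  unfold regSqD
  set m := max (1 - ‖z‖ ^ 2) 0
  have h1 : |1 - 3 * m ^ 2| ≤ 2 := by
    rw [abs_le]; constructor <;> nlinarith [hm.1, hm.2]
  rw [abs_mul, abs_mul, abs_two]
  nlinarith [abs_nonneg (1 - 3 * m ^ 2), abs_nonneg (inner ℝ z e), norm_nonneg z]

lemma abs_regSqDD_le {e : En n} (he : ‖e‖ = 1) (z : En n) : |regSqDD n e z| ≤ 28 := by
  have hm := max_one_sub_sq_mem z
  have hi := sq_le_sq' (abs_le.1 (abs_inner_le_norm_of_unit he z)).1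
    (abs_le.1 (abs_inner_le_norm_of_unit he z)).2
  have hz : ‖z‖ ^ 2 * max (1 - ‖z‖ ^ 2) 0 ≤ 1 := by
    rcases le_total (1 - ‖z‖ ^ 2) 0 with h | h
    · rw [max_eq_right h]; simp
    · rw [max_eq_left h]; nlinarith [sq_nonneg ‖z‖]
  unfold regSqDD
  rw [he]
  set m := max (1 - ‖z‖ ^ 2) 0
  have h2 := mul_le_mul_of_nonneg_right hi hm.1
  have h3 : 0 ≤ (inner ℝ z e) ^ 2 * m := mul_nonneg (sq_nonneg _) hm.1
  rw [abs_le]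
  constructor <;> nlinarith [hm.1, hm.2]

/-- The derivative of `tailKernel` in the direction `e`. -/
def tailKernelD (n : ℕ) (s : ℝ) (e z : En n) : ℝ :=
  -((n:ℝ)/2 + s) * regSq n z ^ (-((n:ℝ)/2 + s) - 1) * regSqD n e z

/-- The second derivative of `tailKernel` in the direction `e`. -/
def tailKernelDD (n : ℕ) (s : ℝ) (e z : En n) : ℝ :=
  -((n:ℝ)/2 + s) * ((-((n:ℝ)/2 + s) - 1) * regSq n z ^ (-((n:ℝ)/2 + s) - 1 - 1)
    * regSqD n e z ^ 2 + regSq n z ^ (-((n:ℝ)/2 + s) - 1) * regSqDD n e z)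

lemma hasLineDerivAt_tailKernel (z e : En n) :
    HasLineDerivAt ℝ (tailKernel n s) (tailKernelD n s e z) z e := by
  have h : HasDerivAt (fun t : ℝ => regSq n (z + t • e)) (regSqD n e z) 0 :=
    hasLineDerivAt_regSq z e
  refine (h.rpow_const (p := -((n:ℝ)/2 + s)) (Or.inl (regSq_pos _).ne')).congr_deriv ?_
  simp [tailKernelD]; ring

lemma hasLineDerivAt_tailKernelD (z e : En n) :
    HasLineDerivAt ℝ (tailKernelD n s e) (tailKernelDD n s e z) z e := by
  have h : HasDerivAt (fun t : ℝ => regSq n (z + t • e)) (regSqD n e z) 0 :=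
    hasLineDerivAt_regSq z e
  have h' : HasDerivAt (fun t : ℝ => regSqD n e (z + t • e)) (regSqDD n e z) 0 :=
    hasLineDerivAt_regSqD z e
  have h1 := h.rpow_const (p := -((n:ℝ)/2 + s) - 1) (Or.inl (regSq_pos _).ne')
  refine ((h1.const_mul (-((n:ℝ)/2 + s))).mul h').congr_deriv ?_
  simp [tailKernelDD]; ring

lemma continuous_tailKernelD (e : En n) : Continuous (tailKernelD n s e) := by
  unfold tailKernelD regSqD
  exact (continuous_const.mul (continuous_regSq.rpow_const fun z => Or.inl (regSq_pos z).ne')).mul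
    (by fun_prop)

lemma continuous_tailKernelDD (e : En n) : Continuous (tailKernelDD n s e) := by
  have h : ∀ p : ℝ, Continuous fun z => regSq n z ^ p := fun p =>
    continuous_regSq.rpow_const fun z => Or.inl (regSq_pos z).ne'
  unfold tailKernelDD regSqD regSqDD
  exact continuous_const.mul (((continuous_const.mul (h _)).mul (by fun_prop)).add
    ((h _).mul (by fun_prop)))

lemma regSq_rpow_sub_one_le (p : ℝ) (z : En n) :
    regSq n z ^ (p - 1) ≤ 2 * regSq n z ^ p := by
  rw [Real.rpow_sub_one (regSq_pos z).ne', div_le_iff₀ (regSq_pos z)]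
  nlinarith [Real.rpow_pos_of_pos (regSq_pos z) p, half_le_regSq z]

lemma abs_tailKernelD_le (hs : s ∈ Ioo (0:ℝ) 1) {e : En n} (he : ‖e‖ = 1) (z : En n) :
    |tailKernelD n s e z| ≤ 200 * ((n:ℝ) + 2) ^ 2 * tailKernel n s z := by
  have ha : 0 ≤ (n:ℝ)/2 + s := by have := hs.1; positivity
  have ha2 : (n:ℝ)/2 + s ≤ n + 2 := by have := hs.2; have : (0:ℝ) ≤ n := n.cast_nonneg; linarith
  have hn0 : (0:ℝ) ≤ n := n.cast_nonneg
  have hB := regSq_pos z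
  have h4 : |regSqD n e z| ≤ 8 * regSq n z := by
    refine (abs_regSqD_le he z).trans ?_
    rcases le_total ‖z‖ 1 with h | h
    · linarith [half_le_regSq z]
    · nlinarith [sq_le_regSq z]
  have h5 : regSq n z ^ (-((n:ℝ)/2 + s) - 1) * |regSqD n e z| ≤ 8 * tailKernel n s z := by
    refine (mul_le_mul_of_nonneg_left h4 (by positivity)).trans (le_of_eq ?_)
    rw [Real.rpow_sub_one hB.ne', tailKernel]
    field_simp
  unfold tailKernelD
  rw [abs_mul, abs_mul, abs_neg, abs_of_nonneg ha, abs_of_nonneg (Real.rpow_nonneg hB.le _),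
    mul_assoc]
  have h6 := mul_le_mul ha2 h5 (by positivity) (by positivity)
  have h7 := tailKernel_pos (s := s) z
  refine h6.trans ?_
  nlinarith [mul_nonneg hn0 h7.le, mul_nonneg (mul_nonneg hn0 hn0) h7.le]

lemma abs_tailKernelDD_le (hs : s ∈ Ioo (0:ℝ) 1) {e : En n} (he : ‖e‖ = 1) (z : En n) :
    |tailKernelDD n s e z| ≤ 200 * ((n:ℝ) + 2) ^ 2 * tailKernel n s z := by
  have ha : 0 ≤ (n:ℝ)/2 + s := by have := hs.1; positivity
  have hn0 : (0:ℝ) ≤ n := n.cast_nonneg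
  have ha2 : (n:ℝ)/2 + s ≤ n + 1 := by have := hs.2; linarith
  have hB := regSq_pos z
  have hT := tailKernel_pos (s := s) z
  set a := (n:ℝ)/2 + s with ha'
  have h1 : regSq n z ^ (-a - 1) ≤ 2 * tailKernel n s z := regSq_rpow_sub_one_le _ z
  have h2 : regSq n z ^ (-a - 1 - 1) * regSqD n e z ^ 2 ≤ 32 * tailKernel n s z := by
    have h3 : regSqD n e z ^ 2 ≤ 16 * regSq n z := by
      have := sq_le_sq' (abs_le.1 (abs_regSqD_le he z)).1 (abs_le.1 (abs_regSqD_le he z)).2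
      nlinarith [sq_le_regSq z]
    refine (mul_le_mul_of_nonneg_left h3 (by positivity)).trans ?_
    rw [Real.rpow_sub_one hB.ne']
    have : regSq n z ^ (-a - 1) / regSq n z * (16 * regSq n z) = 16 * regSq n z ^ (-a - 1) := by
      field_simp
    linarith
  have h3 : regSq n z ^ (-a - 1) * |regSqDD n e z| ≤ 56 * tailKernel n s z := by
    have := mul_le_mul h1 (abs_regSqDD_le he z) (abs_nonneg _) (by positivity)
    linarith
  unfold tailKernelDD
  rw [← ha', abs_mul, abs_neg, abs_of_nonneg ha]
  have h0 : 0 ≤ regSq n z ^ (-a - 1 - 1) * regSqD n e z ^ 2 := by positivity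
  have h4 : |(-a - 1) * regSq n z ^ (-a - 1 - 1) * regSqD n e z ^ 2
      + regSq n z ^ (-a - 1) * regSqDD n e z| ≤ (a + 1) * (32 * tailKernel n s z)
        + 56 * tailKernel n s z := by
    refine (abs_add_le _ _).trans (add_le_add ?_ ?_)
    · have h5 : |-a - 1| = a + 1 := by rw [abs_of_nonpos (by linarith)]; ring
      rw [mul_assoc, abs_mul, abs_of_nonneg h0, h5]
      exact mul_le_mul_of_nonneg_left h2 (by positivity)
    · rw [abs_mul, abs_of_nonneg (by positivity : 0 ≤ regSq n z ^ (-a - 1))]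
      exact h3
  refine (mul_le_mul ha2 (h4.trans (b := (a + 1) * (32 * tailKernel n s z)
    + 56 * tailKernel n s z) (c := ((n:ℝ) + 2) * (32 * tailKernel n s z) + 56 * tailKernel n s z)
    (by gcongr ?_ * _ + _; linarith)) (abs_nonneg _) (by positivity)).trans ?_
  nlinarith [mul_nonneg hn0 hT.le, mul_nonneg (mul_nonneg hn0 hn0) hT.le]

end kernels

/-- The symmetric second difference `2φ(x) - φ(x+z) - φ(x-z)`. -/
def secondDiff (n : ℕ) (φ : En n → ℝ) (x z : En n) : ℝ := 2 * φ x - φ (x + z) - φ (x - z)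

section calculus

variable {n : ℕ} {φ : En n → ℝ}

lemma contDiff_dd (hφ : ContDiff ℝ (⊤ : ℕ∞) φ) (e : En n) :
    ContDiff ℝ (⊤ : ℕ∞) (dd n e φ) := by
  have h : ContDiff ℝ (⊤ : ℕ∞) (fderiv ℝ φ) := hφ.fderiv_right (by simp)
  exact h.clm_apply contDiff_const

lemma hasDerivAt_add_smul (hφ : ContDiff ℝ (⊤ : ℕ∞) φ) (x e : En n) (t : ℝ) :
    HasDerivAt (fun t : ℝ => φ (x + t • e)) (dd n e φ (x + t • e)) t := by
  have h1 : HasFDerivAt φ (fderiv ℝ φ (x + t • e)) (x + t • e) :=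
    (hφ.differentiable (by simp) _).hasFDerivAt
  have h2 : HasDerivAt (fun t : ℝ => x + t • e) e t := by
    simpa using ((hasDerivAt_id t).smul_const e).const_add x
  exact h1.comp_hasDerivAt t h2

lemma abs_dd_le_of_fderiv {M : ℝ} (h : ∀ x, ‖fderiv ℝ φ x‖ ≤ M) {e : En n} (he : ‖e‖ = 1)
    (x : En n) : |dd n e φ x| ≤ M := by
  have := (fderiv ℝ φ x).le_opNorm e
  rw [he, mul_one] at this
  exact this.trans (h x)

lemma dd2_eq_fderiv_fderiv (hφ : ContDiff ℝ (⊤ : ℕ∞) φ) (e e' x : En n) :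
    dd n e' (dd n e φ) x = fderiv ℝ (fderiv ℝ φ) x e' e := by
  have h : ContDiff ℝ (⊤ : ℕ∞) (fderiv ℝ φ) := hφ.fderiv_right (by simp)
  have h1 : HasFDerivAt (fderiv ℝ φ) (fderiv ℝ (fderiv ℝ φ) x) x :=
    (h.differentiable (by simp) x).hasFDerivAt
  have h2 := h1.clm_apply (hasFDerivAt_const e x)
  unfold dd
  rw [h2.fderiv]
  simp

lemma abs_dd2_le_of_fderiv (hφ : ContDiff ℝ (⊤ : ℕ∞) φ) {M : ℝ}
    (h : ∀ x, ‖fderiv ℝ (fderiv ℝ φ) x‖ ≤ M) {e : En n} (he : ‖e‖ = 1)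
    (x : En n) : |dd2 n e φ x| ≤ M := by
  have := (fderiv ℝ (fderiv ℝ φ) x).le_opNorm₂ e e
  rw [he, mul_one, mul_one] at this
  rw [dd2, ← dd, dd2_eq_fderiv_fderiv hφ]
  exact this.trans (h x)

lemma dd_comm (hφ : ContDiff ℝ (⊤ : ℕ∞) φ) (e e' x : En n) :
    dd n e (dd n e' φ) x = dd n e' (dd n e φ) x := by
  rw [dd2_eq_fderiv_fderiv hφ, dd2_eq_fderiv_fderiv hφ]
  refine (hφ.contDiffAt.isSymmSndFDerivAt (n := (⊤ : ℕ∞)) ?_) e e'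
  rw [minSmoothness_of_isRCLikeNormedField]
  exact WithTop.coe_le_coe.2 le_top

lemma exists_abs_secondDiff_le (hφ : ContDiff ℝ (⊤ : ℕ∞) φ) (R : ℝ) :
    ∃ C : ℝ, 0 ≤ C ∧ ∀ x ∈ closedBall (0 : En n) R, ∀ z : En n, ‖z‖ ≤ 1 →
      |secondDiff n φ x z| ≤ C * ‖z‖ ^ 2 := by
  have hd : ContDiff ℝ (⊤ : ℕ∞) (fderiv ℝ φ) := hφ.fderiv_right (by simp)
  have hdd : Continuous (fderiv ℝ (fderiv ℝ φ)) := hd.continuous_fderiv (by simp)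
  obtain ⟨C, hC⟩ := (isCompact_closedBall (0 : En n) (R + 1)).exists_bound_of_continuousOn
    (f := fderiv ℝ (fderiv ℝ φ)) hdd.continuousOn
  refine ⟨max C 0, le_max_right _ _, fun x hx z hz => ?_⟩
  rw [mem_closedBall_zero_iff] at hx
  have key : ∀ y ∈ closedBall (0 : En n) (R + 1), ∀ y' ∈ closedBall (0 : En n) (R + 1),
      ‖fderiv ℝ φ y - fderiv ℝ φ y'‖ ≤ max C 0 * ‖y - y'‖ := fun y hy y' hy' =>
    (convex_closedBall (0 : En n) (R + 1)).norm_image_sub_le_of_norm_fderiv_le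
      (fun w _ => hd.differentiable (by simp) w) (fun w hw => (hC w hw).trans (le_max_left _ _))
      hy' hy
  have hseg : segment ℝ x (x + z) ⊆ {y | y ∈ closedBall (0 : En n) (R + 1) ∧
      y - z ∈ closedBall (0 : En n) (R + 1)} := by
    rintro y ⟨a, b, ha, hb, hab, rfl⟩
    have e1 : a • x + b • (x + z) = x + b • z := by
      rw [smul_add, ← add_assoc, ← add_smul, hab, one_smul]
    have e2 : x + b • z - z = x - a • z := by
      rw [show a = 1 - b by linarith, sub_smul, one_smul]; abel
    simp only [mem_ofPred_eq, mem_closedBall_zero_iff, e1, e2]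
    constructor
    · refine (norm_add_le _ _).trans ?_
      rw [norm_smul, Real.norm_of_nonneg hb]
      nlinarith [norm_nonneg z]
    · refine (norm_sub_le _ _).trans ?_
      rw [norm_smul, Real.norm_of_nonneg ha]
      nlinarith [norm_nonneg z]
  have hψ : ∀ y, HasFDerivAt (fun y => φ y - φ (y - z))
      (fderiv ℝ φ y - fderiv ℝ φ (y - z)) y := fun y => by
    have h1 := (hφ.differentiable (by simp) y).hasFDerivAt
    have h2 := (hφ.differentiable (by simp) (y - z)).hasFDerivAt
    have h3 := h2.comp y ((hasFDerivAt_id y).sub_const z)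
    rw [ContinuousLinearMap.comp_id] at h3
    exact h1.sub h3
  have hm := (convex_segment x (x + z)).norm_image_sub_le_of_norm_hasFDerivWithin_le
    (f := fun y => φ y - φ (y - z)) (C := max C 0 * ‖z‖)
    (fun y _ => (hψ y).hasFDerivWithinAt)
    (fun y hy => by simpa using key y (hseg hy).1 (y - z) (hseg hy).2)
    (left_mem_segment ℝ x (x + z)) (right_mem_segment ℝ x (x + z))
  rw [add_sub_cancel_left, add_sub_cancel_right, Real.norm_eq_abs] at hm
  rw [secondDiff, show 2 * φ x - φ (x + z) - φ (x - z) = -(φ (x + z) - φ x - (φ x - φ (x - z)))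
    by ring, abs_neg]
  exact hm.trans_eq (by ring)

lemma abs_secondDiff_le_of_bdd {M : ℝ} (hM : ∀ x, |φ x| ≤ M) (x z : En n) :
    |secondDiff n φ x z| ≤ 4 * M := by
  have h1 := abs_le.1 (hM x)
  have h2 := abs_le.1 (hM (x + z))
  have h3 := abs_le.1 (hM (x - z))
  unfold secondDiff
  exact abs_le.2 ⟨by linarith, by linarith⟩

lemma continuous_secondDiff (hφ : Continuous φ) (x : En n) : Continuous (secondDiff n φ x) := by
  unfold secondDiff; fun_prop

lemma exists_abs_secondDiff_le_min (hφ : ContDiff ℝ (⊤ : ℕ∞) φ) (hb : ∃ M, ∀ x, |φ x| ≤ M)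
    (R : ℝ) : ∃ C : ℝ, 0 ≤ C ∧ ∀ x ∈ closedBall (0 : En n) R, ∀ z : En n,
      |secondDiff n φ x z| ≤ C * min 1 (‖z‖ ^ 2) := by
  obtain ⟨C, hC0, hC⟩ := exists_abs_secondDiff_le hφ R
  obtain ⟨M, hM⟩ := hb
  have hM0 : 0 ≤ M := (abs_nonneg _).trans (hM 0)
  refine ⟨C + 4 * M, by positivity, fun x hx z => ?_⟩
  rcases le_total ‖z‖ 1 with h | h
  · rw [min_eq_right (pow_le_one₀ (norm_nonneg z) h)]
    exact (hC x hx z h).trans (by gcongr; linarith)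
  · rw [min_eq_left (one_le_pow₀ h)]
    exact (abs_secondDiff_le_of_bdd hM x z).trans (by linarith)

end calculus

section majorant

variable {n : ℕ} {s : ℝ} {φ : En n → ℝ}

lemma sq_mul_fracKernel {z : En n} (hz : z ≠ 0) :
    ‖z‖ ^ 2 * fracKernel n s z = ‖z‖ ^ ((2 - 2 * s) - n) := by
  rw [fracKernel, ← Real.rpow_natCast, ← Real.rpow_add (norm_pos_iff.2 hz)]
  congr 1
  push_cast
  ring

lemma integrable_min_mul_fracKernel (hn : 0 < n) (hs : s ∈ Ioo (0:ℝ) 1) :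
    Integrable (fun z : En n => min 1 (‖z‖ ^ 2) * fracKernel n s z) := by
  have h1 : IntegrableOn (fun z : En n => min 1 (‖z‖ ^ 2) * fracKernel n s z)
      {z : En n | ‖z‖ ∈ Ioc 0 1} := by
    refine (integrableOn_shell (ρ := 1) hn (b := 2 - 2 * s) (by linarith [hs.2])
      le_rfl).congr_fun (fun z hz => ?_) (measurable_norm measurableSet_Ioc)
    have hz' : z ≠ 0 := norm_pos_iff.1 hz.1
    dsimp only
    rw [min_eq_right (pow_le_one₀ (norm_nonneg z) hz.2), sq_mul_fracKernel hz']
  have h2 : IntegrableOn (fun z : En n => min 1 (‖z‖ ^ 2) * fracKernel n s z)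
      {z : En n | ‖z‖ ∈ Ioi 1} := by
    refine (integrableOn_exterior hn (b := -(2 * s)) (by linarith [hs.1])).congr_fun
      (fun z hz => ?_) (measurable_norm measurableSet_Ioi)
    dsimp only
    rw [min_eq_left (one_le_pow₀ (le_of_lt hz)), one_mul, fracKernel]
    congr 1
    ring
  rw [← integrableOn_univ]
  refine ((h1.union h2).union (integrableOn_singleton (x := (0 : En n))
    (hx := isCompact_singleton.measure_lt_top))).mono_set ?_
  intro z _
  by_cases hz : z = 0
  · exact Or.inr hz
  · left
    rcases le_or_gt ‖z‖ 1 with h | h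
    · exact Or.inl ⟨norm_pos_iff.2 hz, h⟩
    · exact Or.inr h

lemma abs_mul_fracKernel_le {a C : ℝ} {z : En n} (h : |a| ≤ C * min 1 (‖z‖ ^ 2)) :
    |a * fracKernel n s z| ≤ C * (min 1 (‖z‖ ^ 2) * fracKernel n s z) := by
  rw [abs_mul, abs_of_nonneg (fracKernel_nonneg z), ← mul_assoc]
  exact mul_le_mul_of_nonneg_right h (fracKernel_nonneg z)

lemma abs_mul_localKernel_le (hs : 0 < s) {a C : ℝ} (hC : 0 ≤ C) {z : En n}
    (h : ‖z‖ ≤ 1 → |a| ≤ C * ‖z‖ ^ 2) :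
    |a * localKernel n s z| ≤ C * (min 1 (‖z‖ ^ 2) * fracKernel n s z) := by
  have hk := fracKernel_nonneg (s := s) z
  rcases lt_or_ge ‖z‖ 1 with h1 | h1
  · by_cases hz : z = 0
    · have h2 := h h1.le
      have : a = 0 := by
        rw [hz] at h2
        simpa using h2
      rw [this]
      simp only [zero_mul, abs_zero]
      positivity
    · rw [min_eq_right (pow_le_one₀ (norm_nonneg z) h1.le), abs_mul,
        abs_of_nonneg (localKernel_nonneg hs hz), ← mul_assoc]
      exact mul_le_mul (h h1.le) (localKernel_le z) (localKernel_nonneg hs hz) (by positivity)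
  · rw [localKernel_of_one_le h1, mul_zero, abs_zero]
    positivity

lemma integrable_secondDiff_mul_fracKernel (hn : 0 < n) (hs : s ∈ Ioo (0:ℝ) 1)
    (hφ : ContDiff ℝ (⊤ : ℕ∞) φ) (hb : ∃ M, ∀ x, |φ x| ≤ M) (x : En n) :
    Integrable (fun z => secondDiff n φ x z * fracKernel n s z) := by
  obtain ⟨C, -, hC⟩ := exists_abs_secondDiff_le_min hφ hb ‖x‖
  refine ((integrable_min_mul_fracKernel hn hs).const_mul C).mono'
    ((continuous_secondDiff hφ.continuous x).measurable.mul
      measurable_fracKernel).aestronglyMeasurable (ae_of_all _ fun z => ?_)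
  exact abs_mul_fracKernel_le (hC x (by simp) z)

lemma integrable_mul_localKernel (hn : 0 < n) (hs : s ∈ Ioo (0:ℝ) 1) {F : En n → ℝ}
    (hF : Continuous F) {C : ℝ} (hC : 0 ≤ C) (h : ∀ z : En n, ‖z‖ ≤ 1 → |F z| ≤ C * ‖z‖ ^ 2) :
    Integrable (fun z => F z * localKernel n s z) :=
  ((integrable_min_mul_fracKernel hn hs).const_mul C).mono'
    (hF.measurable.mul measurable_localKernel).aestronglyMeasurable
    (ae_of_all _ fun z => abs_mul_localKernel_le hs.1 hC (h z))

lemma integrable_secondDiff_mul_localKernel (hn : 0 < n) (hs : s ∈ Ioo (0:ℝ) 1)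
    (hφ : ContDiff ℝ (⊤ : ℕ∞) φ) (x : En n) :
    Integrable (fun z => secondDiff n φ x z * localKernel n s z) := by
  obtain ⟨C, hC0, hC⟩ := exists_abs_secondDiff_le hφ ‖x‖
  exact integrable_mul_localKernel hn hs (continuous_secondDiff hφ.continuous x) hC0
    (hC x (by simp))

lemma integrable_mul_tailKernel (hn : 0 < n) (hs : 0 < s) {F : En n → ℝ} (hF : Continuous F)
    {M : ℝ} (hb : ∀ x, |F x| ≤ M) : Integrable (fun z => F z * tailKernel n s z) :=
  (integrable_tailKernel hn hs).bdd_mul hF.aestronglyMeasurable (ae_of_all _ hb)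

end majorant

/-- The classical operator `-Δ`. -/
def negLap (n : ℕ) (φ : En n → ℝ) (x : En n) : ℝ :=
  -∑ i : Fin n, dd2 n (EuclideanSpace.single i 1) φ x

/-- The fractional Laplacian `(-Δ)^s` of a smooth bounded function, as an absolutely convergent
integral of second differences. -/
def fracOp (n : ℕ) (s : ℝ) (φ : En n → ℝ) (x : En n) : ℝ :=
  if s = 0 then φ x else if s = 1 then negLap n φ x else
    cns n s / 2 * ∫ z, secondDiff n φ x z * fracKernel n s z

/-- The part of `(-Δ)^s` coming from the compactly supported singular kernel `localKernel`. -/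
def localOp (n : ℕ) (s : ℝ) (φ : En n → ℝ) (x : En n) : ℝ :=
  if s = 0 then 0 else if s = 1 then negLap n φ x else
    cns n s / 2 * ∫ z, secondDiff n φ x z * localKernel n s z

/-- The total mass of the regular part of the kernel of `(-Δ)^s`. -/
def tailMass (n : ℕ) (s : ℝ) : ℝ :=
  if s = 0 then 1 else if s = 1 then 0 else cns n s * ∫ z, tailKernel n s z

/-- The convolution with the regular part of the kernel of `(-Δ)^s`. -/
def tailOp (n : ℕ) (s : ℝ) (φ : En n → ℝ) (x : En n) : ℝ :=
  if s = 0 then 0 else if s = 1 then 0 else cns n s * ∫ z, φ (x + z) * tailKernel n s z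

lemma mem_Ioo_of_mem_Icc {s : ℝ} (hs : s ∈ Icc (0:ℝ) 1) (h0 : s ≠ 0) (h1 : s ≠ 1) :
    s ∈ Ioo (0:ℝ) 1 :=
  ⟨lt_of_le_of_ne hs.1 (Ne.symm h0), lt_of_le_of_ne hs.2 h1⟩

section ops

variable {n : ℕ} {s : ℝ} {φ : En n → ℝ}

lemma fracOp_of_mem (hs : s ∈ Ioo (0:ℝ) 1) (x : En n) : fracOp n s φ x =
    cns n s / 2 * ∫ z, secondDiff n φ x z * fracKernel n s z := by
  rw [fracOp, if_neg hs.1.ne', if_neg hs.2.ne]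

lemma localOp_of_mem (hs : s ∈ Ioo (0:ℝ) 1) (x : En n) : localOp n s φ x =
    cns n s / 2 * ∫ z, secondDiff n φ x z * localKernel n s z := by
  rw [localOp, if_neg hs.1.ne', if_neg hs.2.ne]

lemma tailMass_of_mem (hs : s ∈ Ioo (0:ℝ) 1) :
    tailMass n s = cns n s * ∫ z, tailKernel n s z := by
  rw [tailMass, if_neg hs.1.ne', if_neg hs.2.ne]

lemma tailOp_of_mem (hs : s ∈ Ioo (0:ℝ) 1) (x : En n) :
    tailOp n s φ x = cns n s * ∫ z, φ (x + z) * tailKernel n s z := by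
  rw [tailOp, if_neg hs.1.ne', if_neg hs.2.ne]

lemma fracOp_eq_localOp (hn : 0 < n) (hs : s ∈ Icc (0:ℝ) 1) (hφ : ContDiff ℝ (⊤ : ℕ∞) φ)
    (hb : ∃ M, ∀ x, |φ x| ≤ M) (x : En n) :
    fracOp n s φ x = localOp n s φ x + tailMass n s * φ x - tailOp n s φ x := by
  by_cases h0 : s = 0
  · simp [fracOp, localOp, tailMass, tailOp, h0]
  by_cases h1 : s = 1
  · simp [fracOp, localOp, tailMass, tailOp, h1]
  have hs' := mem_Ioo_of_mem_Icc hs h0 h1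
  obtain ⟨M, hM⟩ := hb
  rw [fracOp_of_mem hs', localOp_of_mem hs', tailMass_of_mem hs', tailOp_of_mem hs']
  have i1 := integrable_secondDiff_mul_localKernel hn hs' hφ x
  have i2 : Integrable (fun z => φ x * tailKernel n s z) :=
    (integrable_tailKernel hn hs'.1).const_mul _
  have i3 : Integrable (fun z => φ (x + z) * tailKernel n s z) :=
    integrable_mul_tailKernel hn hs'.1 (F := fun z => φ (x + z))
      (by have := hφ.continuous; fun_prop) (fun z => hM _)
  have i4 : Integrable (fun z => φ (x - z) * tailKernel n s z) :=
    integrable_mul_tailKernel hn hs'.1 (F := fun z => φ (x - z))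
      (by have := hφ.continuous; fun_prop) (fun z => hM _)
  have e4 : ∫ z, φ (x - z) * tailKernel n s z = ∫ z, φ (x + z) * tailKernel n s z := by
    rw [← integral_neg_eq_self]
    simp_rw [tailKernel_neg, sub_neg_eq_add]
  have e : ∀ z, secondDiff n φ x z * fracKernel n s z = secondDiff n φ x z * localKernel n s z
      + 2 * (φ x * tailKernel n s z) - φ (x + z) * tailKernel n s z
      - φ (x - z) * tailKernel n s z := fun z => by
    unfold localKernel secondDiff; ring
  simp_rw [e]
  have i12 : Integrable (fun z => secondDiff n φ x z * localKernel n s z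
      + 2 * (φ x * tailKernel n s z)) := i1.add (i2.const_mul 2)
  have i123 : Integrable (fun z => secondDiff n φ x z * localKernel n s z
      + 2 * (φ x * tailKernel n s z) - φ (x + z) * tailKernel n s z) := i12.sub i3
  rw [integral_sub i123 i4, integral_sub i12 i3, integral_add i1 (i2.const_mul 2),
    integral_const_mul, integral_const_mul, e4]
  ring

lemma fracLap_eq (hn : 0 < n) (hs : s ∈ Ioo (0:ℝ) 1) (hφ : ContDiff ℝ (⊤ : ℕ∞) φ)
    (hb : ∃ M, ∀ x, |φ x| ≤ M) (x : En n) :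
    fracLap n s φ x = cns n s / 2 * ∫ z, secondDiff n φ x z * fracKernel n s z := by
  have hcont := hφ.continuous
  have hint := integrable_secondDiff_mul_fracKernel hn hs hφ hb x
  have hmeas : ∀ ε : ℝ, MeasurableSet {z : En n | ε ≤ ‖z‖} := fun ε =>
    measurableSet_le measurable_const measurable_norm
  have htrunc : ∀ ε : ℝ, 0 < ε → (∫ y in {y : En n | ε ≤ dist y x},
      (φ x - φ y) * (cns n s * ‖x - y‖ ^ (-((n:ℝ) + 2*s))))
      = cns n s / 2 * ∫ z in {z : En n | ε ≤ ‖z‖}, secondDiff n φ x z * fracKernel n s z := by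
    intro ε hε
    obtain ⟨M, hM⟩ := hb
    have hk : IntegrableOn (fracKernel n s) {z : En n | ε ≤ ‖z‖} := by
      have hm : 0 < min 1 (ε ^ 2) := by positivity
      refine ((integrable_min_mul_fracKernel hn hs).integrableOn.const_mul
        (min 1 (ε ^ 2))⁻¹).mono' measurable_fracKernel.aestronglyMeasurable ?_
      filter_upwards [ae_restrict_mem (hmeas ε)] with z hz
      rw [Real.norm_of_nonneg (fracKernel_nonneg z), ← mul_assoc]
      refine le_mul_of_one_le_left (fracKernel_nonneg z) ?_
      rw [inv_mul_eq_div, one_le_div hm]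
      exact min_le_min le_rfl (pow_le_pow_left₀ hε.le hz 2)
    have i1 : IntegrableOn (fun z => (φ x - φ (x + z)) * fracKernel n s z)
        {z : En n | ε ≤ ‖z‖} := by
      refine Integrable.bdd_mul (c := 2 * M) hk (Continuous.aestronglyMeasurable (by fun_prop))
        (ae_of_all _ fun z => ?_)
      rw [Real.norm_eq_abs]
      exact (abs_sub _ _).trans (by linarith [hM x, hM (x + z)])
    have i2 : IntegrableOn (fun z => (φ x - φ (x - z)) * fracKernel n s z)
        {z : En n | ε ≤ ‖z‖} := by
      refine Integrable.bdd_mul (c := 2 * M) hk (Continuous.aestronglyMeasurable (by fun_prop))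
        (ae_of_all _ fun z => ?_)
      rw [Real.norm_eq_abs]
      exact (abs_sub _ _).trans (by linarith [hM x, hM (x - z)])
    have e1 : (∫ y in {y : En n | ε ≤ dist y x},
        (φ x - φ y) * (cns n s * ‖x - y‖ ^ (-((n:ℝ) + 2*s))))
        = cns n s * ∫ z in {z : En n | ε ≤ ‖z‖}, (φ x - φ (x + z)) * fracKernel n s z := by
      rw [← integral_indicator (measurableSet_le measurable_const (by fun_prop)),
        ← integral_indicator (hmeas ε), ← integral_const_mul, ← integral_add_left_eq_self _ x]
      congr 1 with z
      by_cases hz : ε ≤ ‖z‖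
      · rw [indicator_of_mem (by simpa using hz), indicator_of_mem (by simpa using hz), fracKernel,
          sub_add_cancel_left, norm_neg]
        ring
      · rw [indicator_of_notMem (by simpa using hz), indicator_of_notMem (by simpa using hz),
          mul_zero]
    have e2 : ∫ z in {z : En n | ε ≤ ‖z‖}, (φ x - φ (x + z)) * fracKernel n s z
        = ∫ z in {z : En n | ε ≤ ‖z‖}, (φ x - φ (x - z)) * fracKernel n s z := by
      rw [← integral_indicator (hmeas ε), ← integral_indicator (hmeas ε), ← integral_neg_eq_self]
      congr 1 with z
      by_cases hz : ε ≤ ‖z‖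
      · rw [indicator_of_mem (by simpa using hz), indicator_of_mem (by simpa using hz),
          fracKernel_neg, sub_eq_add_neg x z]
      · rw [indicator_of_notMem (by simpa using hz), indicator_of_notMem (by simpa using hz)]
    have e3 : ∫ z in {z : En n | ε ≤ ‖z‖}, secondDiff n φ x z * fracKernel n s z
        = (∫ z in {z : En n | ε ≤ ‖z‖}, (φ x - φ (x + z)) * fracKernel n s z)
        + ∫ z in {z : En n | ε ≤ ‖z‖}, (φ x - φ (x - z)) * fracKernel n s z := by
      rw [← integral_add i1 i2]
      congr 1 with z
      unfold secondDiff
      ring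
    rw [e1, e3, ← e2]
    ring
  have hlim : Tendsto (fun ε : ℝ => cns n s / 2 *
      ∫ z in {z : En n | ε ≤ ‖z‖}, secondDiff n φ x z * fracKernel n s z) (nhdsWithin 0 (Ioi 0))
      (nhds (cns n s / 2 * ∫ z, secondDiff n φ x z * fracKernel n s z)) := by
    refine Tendsto.const_mul _ ?_
    simp_rw [fun ε => (integral_indicator (μ := volume)
      (f := fun z => secondDiff n φ x z * fracKernel n s z) (hmeas ε)).symm]
    refine tendsto_integral_filter_of_dominated_convergence
      (fun z => |secondDiff n φ x z * fracKernel n s z|)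
      (Eventually.of_forall fun ε => hint.aestronglyMeasurable.indicator (hmeas ε))
      (Eventually.of_forall fun ε => ae_of_all _ fun z => norm_indicator_le_norm_self _ _)
      hint.abs (ae_of_all _ fun z => ?_)
    refine tendsto_const_nhds.congr' ?_
    by_cases hz : z = 0
    · filter_upwards with ε
      have : secondDiff n φ x z = 0 := by simp [secondDiff, hz]; ring
      simp [indicator, this]
    · filter_upwards [Ioo_mem_nhdsGT (norm_pos_iff.2 hz)] with ε hε
      rw [indicator_of_mem (show z ∈ {z : En n | ε ≤ ‖z‖} from hε.2.le)]
  unfold fracLap opK pvAt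
  refine Tendsto.limUnder_eq (hlim.congr' ?_)
  filter_upwards [self_mem_nhdsWithin] with ε hε
  exact (htrunc ε hε).symm

lemma tendsto_second_difference {G G' : ℝ → ℝ} {g : ℝ} (hG : ∀ t, HasDerivAt G (G' t) t)
    (hG' : HasDerivAt G' g 0) :
    Tendsto (fun h => (2 * G 0 - G h - G (-h)) / h ^ 2) (nhdsWithin 0 (Ioi 0)) (nhds (-g)) := by
  have h1 : ∀ t, HasDerivAt (fun h => 2 * G 0 - G h - G (-h)) (-(G' t - G' (-t))) t := fun t => by
    exact (((hG t).const_sub (2 * G 0)).sub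
      ((hG (-t)).comp t (hasDerivAt_neg t))).congr_deriv (by ring)
  have h2 : ∀ t : ℝ, HasDerivAt (fun h : ℝ => h ^ 2) (2 * t) t := fun t => by
    simpa using hasDerivAt_pow 2 t
  have h3 : HasDerivAt (fun t => G' t - G' (-t)) (2 * g) 0 := by
    have h := hG'.sub (HasDerivAt.comp (0:ℝ) (h₂ := G') (by simpa using hG') (hasDerivAt_neg 0))
    exact h.congr_deriv (by ring)
  have h4 := hasDerivAt_iff_tendsto_slope_zero.1 h3
  have h5 : Tendsto (fun t => -(G' t - G' (-t)) / (2 * t)) (nhdsWithin 0 (Ioi 0)) (nhds (-g)) := by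
    have := (h4.mono_left (nhdsWithin_mono 0 (fun t ht => ne_of_gt ht))).const_mul (-(1/2 : ℝ))
    rw [show -(1/2 : ℝ) * (2 * g) = -g by ring] at this
    refine this.congr' ?_
    filter_upwards [self_mem_nhdsWithin] with t ht
    have : t ≠ 0 := ne_of_gt ht
    simp
    field_simp
    ring
  refine HasDerivAt.lhopital_zero_nhdsGT (Eventually.of_forall h1) (Eventually.of_forall h2)
    ?_ ?_ ?_ h5
  · filter_upwards [self_mem_nhdsWithin] with t ht
    have : t ≠ 0 := ne_of_gt ht
    positivity
  · have := (h1 0).continuousAt.tendsto.mono_left (nhdsWithin_le_nhds (s := Ioi 0))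
    simpa [two_mul] using this
  · have := (h2 0).continuousAt.tendsto.mono_left (nhdsWithin_le_nhds (s := Ioi 0))
    simpa using this

lemma negLapInc_eq (hφ : ContDiff ℝ (⊤ : ℕ∞) φ) (x : En n) : negLapInc n φ x = negLap n φ x := by
  unfold negLapInc negLap
  rw [← Finset.sum_neg_distrib]
  refine Tendsto.liminf_eq (tendsto_finsetSum _ fun i _ => ?_)
  have h1 := hasDerivAt_add_smul hφ x (EuclideanSpace.single i 1)
  have h2 := hasDerivAt_add_smul (contDiff_dd hφ (EuclideanSpace.single i 1)) x
    (EuclideanSpace.single i 1) 0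
  have := tendsto_second_difference h1 h2
  simpa [sub_eq_add_neg, dd2, dd] using this

lemma fracLapE_eq_fracOp (hn : 0 < n) (hs : s ∈ Icc (0:ℝ) 1) (hφ : ContDiff ℝ (⊤ : ℕ∞) φ)
    (hb : ∃ M, ∀ x, |φ x| ≤ M) (x : En n) : fracLapE n s φ x = fracOp n s φ x := by
  unfold fracLapE fracOp
  split_ifs with h0 h1
  · rfl
  · exact negLapInc_eq hφ x
  · exact fracLap_eq hn (mem_Ioo_of_mem_Icc hs h0 h1) hφ hb x

end ops

section opscalc

variable {n : ℕ} {s : ℝ} {φ : En n → ℝ}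

lemma hasDerivAt_secondDiff_line (hφ : ContDiff ℝ (⊤ : ℕ∞) φ) (x e z : En n) (t : ℝ) :
    HasDerivAt (fun t : ℝ => secondDiff n φ (x + t • e) z)
      (secondDiff n (dd n e φ) (x + t • e) z) t := by
  have h1 := (hasDerivAt_add_smul hφ x e t).const_mul 2
  have h2 := hasDerivAt_add_smul hφ (x + z) e t
  have h3 := hasDerivAt_add_smul hφ (x - z) e t
  simp_rw [add_right_comm x z] at h2
  simp_rw [sub_add_eq_add_sub] at h3
  exact (h1.sub h2).sub h3

lemma hasDerivAt_fracOp (hn : 0 < n) (hs : s ∈ Icc (0:ℝ) 1) (hφ : ContDiff ℝ (⊤ : ℕ∞) φ)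
    {e : En n} (hb : ∃ M, ∀ x, |φ x| ≤ M) (hb' : ∃ M, ∀ x, |dd n e φ x| ≤ M) (x : En n)
    (t : ℝ) : HasDerivAt (fun t : ℝ => fracOp n s φ (x + t • e))
      (fracOp n s (dd n e φ) (x + t • e)) t := by
  by_cases h0 : s = 0
  · simpa [fracOp, h0] using hasDerivAt_add_smul hφ x e t
  by_cases h1 : s = 1
  · simp only [fracOp, h1, if_true, one_ne_zero, if_false, negLap]
    refine HasDerivAt.fun_neg (HasDerivAt.fun_sum fun i _ => ?_)
    set a : En n := EuclideanSpace.single i 1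
    have h := hasDerivAt_add_smul (contDiff_dd (contDiff_dd hφ a) a) x e t
    have e1 : dd n e (dd n a φ) = dd n a (dd n e φ) := funext (dd_comm hφ e a)
    rw [dd_comm (contDiff_dd hφ a), e1] at h
    exact h
  have hs' := mem_Ioo_of_mem_Icc hs h0 h1
  simp_rw [fracOp_of_mem hs']
  refine HasDerivAt.const_mul _ ?_
  obtain ⟨C, hC0, hC⟩ := exists_abs_secondDiff_le_min (contDiff_dd hφ e) hb'
    (‖x‖ + (|t| + 1) * ‖e‖)
  refine (hasDerivAt_integral_of_dominated_loc_of_deriv_le (s := ball t 1)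
    (F := fun t z => secondDiff n φ (x + t • e) z * fracKernel n s z)
    (F' := fun t z => secondDiff n (dd n e φ) (x + t • e) z * fracKernel n s z)
    (bound := fun z => C * (min 1 (‖z‖ ^ 2) * fracKernel n s z))
    (ball_mem_nhds t one_pos) (Eventually.of_forall fun r => ?_)
    (integrable_secondDiff_mul_fracKernel hn hs' hφ hb _) ?_ (ae_of_all _ fun z r hr => ?_)
    ((integrable_min_mul_fracKernel hn hs').const_mul C)
    (ae_of_all _ fun z r _ => (hasDerivAt_secondDiff_line hφ x e z r).mul_const _)).2
  · exact (integrable_secondDiff_mul_fracKernel hn hs' hφ hb _).aestronglyMeasurable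
  · exact (integrable_secondDiff_mul_fracKernel hn hs' (contDiff_dd hφ e) hb'
      _).aestronglyMeasurable
  · refine abs_mul_fracKernel_le (hC _ ?_ z)
    rw [mem_closedBall_zero_iff]
    refine (norm_add_le _ _).trans ?_
    rw [norm_smul, Real.norm_eq_abs]
    have : |r| ≤ |t| + 1 := by
      rw [mem_ball, Real.dist_eq] at hr
      have := abs_sub_abs_le_abs_sub r t
      linarith
    gcongr

lemma dd_const_mul_comp (hφ : ContDiff ℝ (⊤ : ℕ∞) φ) (c r : ℝ) (x₀ e y : En n) :
    dd n e (fun y => c * φ (x₀ + r • y)) y = c * r * dd n e φ (x₀ + r • y) := by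
  have h1 : HasFDerivAt φ (fderiv ℝ φ (x₀ + r • y)) (x₀ + r • y) :=
    (hφ.differentiable (by simp) _).hasFDerivAt
  have h2 : HasFDerivAt (fun y : En n => x₀ + r • y) (r • ContinuousLinearMap.id ℝ (En n)) y :=
    ((hasFDerivAt_id y).const_smul r).const_add x₀
  have h3 := (h1.comp y h2).const_mul c
  unfold dd
  rw [HasFDerivAt.fderiv (f := fun y => c * φ (x₀ + r • y)) h3]
  simp
  ring

lemma contDiff_const_mul_comp (hφ : ContDiff ℝ (⊤ : ℕ∞) φ) (c r : ℝ) (x₀ : En n) :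
    ContDiff ℝ (⊤ : ℕ∞) (fun y => c * φ (x₀ + r • y)) := by fun_prop

lemma fracOp_const_mul_comp (hs : s ∈ Icc (0:ℝ) 1)
    (hφ : ContDiff ℝ (⊤ : ℕ∞) φ) (c : ℝ) {r : ℝ} (hr : 0 < r) (x₀ y : En n) :
    fracOp n s (fun y => c * φ (x₀ + r • y)) y
      = c * r ^ (2 * s) * fracOp n s φ (x₀ + r • y) := by
  by_cases h0 : s = 0
  · simp [fracOp, h0]
  by_cases h1 : s = 1
  · simp only [fracOp, h1, if_true, one_ne_zero, if_false, negLap, dd2]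
    rw [mul_neg, Finset.mul_sum]
    congr 1
    refine Finset.sum_congr rfl fun i _ => ?_
    set a : En n := EuclideanSpace.single i 1
    change dd n a (dd n a _) y = _ * dd n a _ _
    rw [show dd n a (fun y => c * φ (x₀ + r • y)) = fun y => c * r * dd n a φ (x₀ + r • y) from
      funext fun y => dd_const_mul_comp hφ c r x₀ a y, dd_const_mul_comp (contDiff_dd hφ a)]
    rw [mul_one, Real.rpow_two]
    ring
  have hs' := mem_Ioo_of_mem_Icc hs h0 h1
  rw [fracOp_of_mem hs', fracOp_of_mem hs']
  have e1 : ∀ z, secondDiff n (fun y => c * φ (x₀ + r • y)) y z * fracKernel n s z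
      = c * r ^ ((n:ℝ) + 2 * s) * ((fun z => secondDiff n φ (x₀ + r • y) z * fracKernel n s z)
        (r • z)) := fun z => by
    have e2 : fracKernel n s (r • z) = r ^ (-((n:ℝ) + 2 * s)) * fracKernel n s z := by
      rw [fracKernel, norm_smul, Real.norm_of_nonneg hr.le,
        Real.mul_rpow hr.le (norm_nonneg _), fracKernel]
    dsimp only
    rw [e2, Real.rpow_neg hr.le]
    have : r ^ ((n:ℝ) + 2 * s) ≠ 0 := (Real.rpow_pos_of_pos hr _).ne'
    simp only [secondDiff, smul_add, smul_sub, add_assoc, add_sub_assoc]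
    field_simp
  have e3 := Measure.integral_comp_smul volume
    (fun z => secondDiff n φ (x₀ + r • y) z * fracKernel n s z) r
  simp_rw [e1]
  rw [integral_const_mul, e3, finrank_euclideanSpace_fin, smul_eq_mul,
    abs_of_nonneg (by positivity), Real.rpow_add hr, Real.rpow_natCast]
  field_simp

lemma dd_sub_const (c : ℝ) (e : En n) : dd n e (fun x => φ x - c) = dd n e φ := by
  funext x
  simp [dd, fderiv_sub_const]

lemma localOp_sub_const (c : ℝ) (x : En n) :
    localOp n s (fun x => φ x - c) x = localOp n s φ x := by
  have : ∀ z, secondDiff n (fun x => φ x - c) x z = secondDiff n φ x z := fun z => by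
    simp only [secondDiff]; ring
  have h2 : ∀ e, dd2 n e (fun x => φ x - c) = dd2 n e φ := fun e => by
    funext x; rw [dd2, dd_sub_const, ← dd2]
  unfold localOp negLap
  simp_rw [this, h2]

lemma integral_mul_lineDeriv_eq {f f' g g' : En n → ℝ} {e : En n}
    (h1 : Integrable fun z => f' z * g z) (h2 : Integrable fun z => f z * g' z)
    (h3 : Integrable fun z => f z * g z) (hf : ∀ z, HasLineDerivAt ℝ f (f' z) z e)
    (hg : ∀ z, HasLineDerivAt ℝ g (g' z) z e) :
    ∫ z, f' z * g z = -∫ z, f z * g' z := by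
  have := integral_bilinear_hasLineDerivAt_right_eq_neg_left_of_integrable
    (μ := (volume : Measure (En n))) (B := ContinuousLinearMap.mul ℝ ℝ) (f := f) (f' := f')
    (g := g) (g' := g') (v := e) h1 h2 h3 (fun z _ => hf z) (fun z _ => hg z)
  simp only [ContinuousLinearMap.mul_apply'] at this
  rw [this, neg_neg]

lemma hasLineDerivAt_const_add (hφ : ContDiff ℝ (⊤ : ℕ∞) φ) (x z e : En n) :
    HasLineDerivAt ℝ (fun z => φ (x + z)) (dd n e φ (x + z)) z e := by
  have := hasDerivAt_add_smul hφ (x + z) e 0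
  simpa [HasLineDerivAt, add_assoc] using this

lemma tailMass_nonneg (hn : 0 < n) (hs : s ∈ Icc (0:ℝ) 1) : 0 ≤ tailMass n s := by
  unfold tailMass
  split_ifs with h0 h1
  · exact zero_le_one
  · exact le_rfl
  · have hs' := mem_Ioo_of_mem_Icc hs h0 h1
    exact mul_nonneg (cns_pos hn hs').le (integral_nonneg fun z => (tailKernel_pos z).le)

lemma exists_tailMass_le (hn : 0 < n) :
    ∃ C : ℝ, 1 ≤ C ∧ ∀ s ∈ Icc (0:ℝ) 1, tailMass n s ≤ C := by
  obtain ⟨C, hC0, hC⟩ := exists_cns_mul_integral_tailKernel_le hn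
  refine ⟨C + 1, by linarith, fun s hs => ?_⟩
  unfold tailMass
  split_ifs with h0 h1
  · linarith
  · linarith
  · linarith [hC s (mem_Ioo_of_mem_Icc hs h0 h1)]

lemma exists_abs_tailOp_le (hn : 0 < n) :
    ∃ C : ℝ, 0 < C ∧ ∀ s ∈ Icc (0:ℝ) 1, ∀ (U : En n → ℝ) (e : En n) (M : ℝ),
      ContDiff ℝ (⊤ : ℕ∞) U → ‖e‖ = 1 → (∀ x, |U x| ≤ M) →
      (∃ M', ∀ x, |dd n e U x| ≤ M') → (∃ M', ∀ x, |dd n e (dd n e U) x| ≤ M') →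
      ∀ x, |tailOp n s U x| ≤ C * M ∧ |tailOp n s (dd n e U) x| ≤ C * M ∧
        |tailOp n s (dd n e (dd n e U)) x| ≤ C * M := by
  obtain ⟨C, hC0, hC⟩ := exists_cns_mul_integral_tailKernel_le hn
  refine ⟨200 * ((n:ℝ) + 2) ^ 2 * C, by positivity, fun s hs U e M hU he hM hM1 hM2 x => ?_⟩
  have hM0 : 0 ≤ M := (abs_nonneg _).trans (hM 0)
  unfold tailOp
  by_cases h0 : s = 0
  · simp only [h0, if_true, abs_zero]
    have : 0 ≤ 200 * ((n:ℝ) + 2) ^ 2 * C * M := by positivity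
    exact ⟨this, this, this⟩
  by_cases h1 : s = 1
  · simp only [h1, if_true, one_ne_zero, if_false, abs_zero]
    have : 0 ≤ 200 * ((n:ℝ) + 2) ^ 2 * C * M := by positivity
    exact ⟨this, this, this⟩
  have hs' := mem_Ioo_of_mem_Icc hs h0 h1
  simp only [h0, h1, if_false]
  obtain ⟨M1, hM1⟩ := hM1
  obtain ⟨M2, hM2⟩ := hM2
  have hc := cns_pos hn hs'
  have hT := integrable_tailKernel hn hs'.1 (n := n)
  have hA : (1:ℝ) ≤ 200 * ((n:ℝ) + 2) ^ 2 := by nlinarith [Nat.cast_nonneg (α := ℝ) n]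
  have hU1 := contDiff_dd hU e
  have hU2 := contDiff_dd hU1 e
  have iD : Integrable (tailKernelD n s e) :=
    (hT.const_mul (200 * ((n:ℝ) + 2) ^ 2)).mono' (continuous_tailKernelD e).aestronglyMeasurable
      (ae_of_all _ fun z => abs_tailKernelD_le hs' he z)
  have iDD : Integrable (tailKernelDD n s e) :=
    (hT.const_mul (200 * ((n:ℝ) + 2) ^ 2)).mono' (continuous_tailKernelDD e).aestronglyMeasurable
      (ae_of_all _ fun z => abs_tailKernelDD_le hs' he z)
  have hcx : ∀ {F : En n → ℝ}, Continuous F → AEStronglyMeasurable (fun z => F (x + z)) := by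
    intro F hF
    exact Continuous.aestronglyMeasurable (by fun_prop)
  have main : ∀ k : En n → ℝ, (∀ z, |k z| ≤ 200 * ((n:ℝ) + 2) ^ 2 * tailKernel n s z) →
      |cns n s * ∫ z, U (x + z) * k z| ≤ 200 * ((n:ℝ) + 2) ^ 2 * C * M := by
    intro k hk
    have h2 : |∫ z, U (x + z) * k z| ≤ ∫ z, M * (200 * ((n:ℝ) + 2) ^ 2 * tailKernel n s z) := by
      rw [← Real.norm_eq_abs]
      refine norm_integral_le_of_norm_le ((hT.const_mul _).const_mul _) (ae_of_all _ fun z => ?_)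
      rw [norm_mul]
      exact mul_le_mul (hM _) (hk z) (abs_nonneg _) hM0
    rw [integral_const_mul, integral_const_mul] at h2
    rw [abs_mul, abs_of_pos hc]
    calc cns n s * |∫ z, U (x + z) * k z|
        ≤ cns n s * (M * (200 * ((n:ℝ) + 2) ^ 2 * ∫ z, tailKernel n s z)) := by gcongr
      _ = 200 * ((n:ℝ) + 2) ^ 2 * M * (cns n s * ∫ z, tailKernel n s z) := by ring
      _ ≤ 200 * ((n:ℝ) + 2) ^ 2 * M * C := by gcongr; exact hC s hs'
      _ = _ := by ring
  have ibp1 := integral_mul_lineDeriv_eq (f := fun z => U (x + z))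
    (f' := fun z => dd n e U (x + z)) (g := tailKernel n s) (g' := tailKernelD n s e)
    (hT.bdd_mul (hcx hU1.continuous) (ae_of_all _ fun z =>
      hM1 (x + z))) (iD.bdd_mul (hcx hU.continuous) (ae_of_all _ fun z => hM (x + z)))
    (hT.bdd_mul (hcx hU.continuous) (ae_of_all _ fun z => hM (x + z)))
    (fun z => hasLineDerivAt_const_add hU x z e) (fun z => hasLineDerivAt_tailKernel z e)
  have ibp2 := integral_mul_lineDeriv_eq (f := fun z => dd n e U (x + z))
    (f' := fun z => dd n e (dd n e U) (x + z)) (g := tailKernel n s) (g' := tailKernelD n s e)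
    (hT.bdd_mul (hcx hU2.continuous) (ae_of_all _ fun z =>
      hM2 (x + z))) (iD.bdd_mul (hcx hU1.continuous) (ae_of_all _ fun z => hM1 (x + z)))
    (hT.bdd_mul (hcx hU1.continuous) (ae_of_all _ fun z => hM1 (x + z)))
    (fun z => hasLineDerivAt_const_add hU1 x z e) (fun z => hasLineDerivAt_tailKernel z e)
  have ibp3 := integral_mul_lineDeriv_eq (f := fun z => U (x + z))
    (f' := fun z => dd n e U (x + z)) (g := tailKernelD n s e) (g' := tailKernelDD n s e)
    (iD.bdd_mul (hcx hU1.continuous) (ae_of_all _ fun z =>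
      hM1 (x + z))) (iDD.bdd_mul (hcx hU.continuous) (ae_of_all _ fun z => hM (x + z)))
    (iD.bdd_mul (hcx hU.continuous) (ae_of_all _ fun z => hM (x + z)))
    (fun z => hasLineDerivAt_const_add hU x z e) (fun z => hasLineDerivAt_tailKernelD z e)
  refine ⟨main _ fun z => ?_, ?_, ?_⟩
  · rw [abs_of_pos (tailKernel_pos z)]
    exact le_mul_of_one_le_left (tailKernel_pos z).le hA
  · rw [ibp1, mul_neg, abs_neg]
    exact main _ (abs_tailKernelD_le hs' he)
  · rw [ibp2, ibp3, neg_neg]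
    exact main _ (abs_tailKernelDD_le hs' he)

end opscalc

/-- A smoothed and truncated version of `‖z‖² ‖z‖^{-n-2s}`, supported in the ball of
radius `1/2`. -/
def cutKernel (n : ℕ) (s τ : ℝ) (z : En n) : ℝ :=
  max (1 / 4 - ‖z‖ ^ 2) 0 ^ 2 * (‖z‖ ^ 2 + τ ^ 2) ^ (1 - ((n:ℝ)/2 + s))

/-- The derivative of `cutKernel` in the direction `e`. -/
def cutKernelD (n : ℕ) (s τ : ℝ) (e z : En n) : ℝ :=
  -(4 * max (1 / 4 - ‖z‖ ^ 2) 0 * inner ℝ z e) * (‖z‖ ^ 2 + τ ^ 2) ^ (1 - ((n:ℝ)/2 + s))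
    + max (1 / 4 - ‖z‖ ^ 2) 0 ^ 2 * ((1 - ((n:ℝ)/2 + s)) * (2 * inner ℝ z e)
      * (‖z‖ ^ 2 + τ ^ 2) ^ (-((n:ℝ)/2 + s)))

section cut

variable {n : ℕ} {s τ : ℝ}

lemma sq_add_sq_pos (hτ : 0 < τ) (z : En n) : 0 < ‖z‖ ^ 2 + τ ^ 2 := by positivity

lemma max_quarter_sub_eq_zero {z : En n} (hz : 1 / 2 ≤ ‖z‖) : max (1 / 4 - ‖z‖ ^ 2) 0 = 0 :=
  max_eq_right (by nlinarith)

lemma max_quarter_sub_mem (z : En n) : max (1 / 4 - ‖z‖ ^ 2) 0 ∈ Icc (0:ℝ) (1 / 4) :=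
  ⟨le_max_right _ _, max_le (by linarith [sq_nonneg ‖z‖]) (by norm_num)⟩

lemma cutKernel_of_half_le {z : En n} (hz : 1 / 2 ≤ ‖z‖) : cutKernel n s τ z = 0 := by
  rw [cutKernel, max_quarter_sub_eq_zero hz]; simp

lemma cutKernelD_of_half_le {e z : En n} (hz : 1 / 2 ≤ ‖z‖) : cutKernelD n s τ e z = 0 := by
  rw [cutKernelD, max_quarter_sub_eq_zero hz]; simp

lemma continuous_cutKernel (hτ : 0 < τ) : Continuous (cutKernel n s τ) := by
  unfold cutKernel
  refine Continuous.mul (by fun_prop) (Continuous.rpow_const (by fun_prop) fun z => ?_)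
  exact Or.inl (sq_add_sq_pos hτ z).ne'

lemma continuous_cutKernelD (hτ : 0 < τ) (e : En n) : Continuous (cutKernelD n s τ e) := by
  unfold cutKernelD
  have h : ∀ p : ℝ, Continuous fun z : En n => (‖z‖ ^ 2 + τ ^ 2) ^ p := fun p =>
    Continuous.rpow_const (by fun_prop) fun z => Or.inl (sq_add_sq_pos hτ z).ne'
  have h1 := h (1 - ((n:ℝ)/2 + s))
  have h2 := h (-((n:ℝ)/2 + s))
  fun_prop

lemma hasLineDerivAt_cutKernel (hτ : 0 < τ) (z e : En n) :
    HasLineDerivAt ℝ (cutKernel n s τ) (cutKernelD n s τ e z) z e := by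
  have h := hasDerivAt_norm_sq_line z e
  have h2 := (hasDerivAt_max_zero_pow 0 (1 / 4 - ‖z + (0:ℝ) • e‖ ^ 2)).comp 0
    (h.const_sub (1 / 4))
  have h3 := (h.add_const (τ ^ 2)).rpow_const (p := 1 - ((n:ℝ)/2 + s))
    (Or.inl (sq_add_sq_pos hτ _).ne')
  unfold HasLineDerivAt
  refine ((h2.mul h3).congr_deriv ?_).congr_of_eventuallyEq (Eventually.of_forall fun t => ?_)
  · simp only [cutKernelD, zero_smul, add_zero, Function.comp_apply,
      show 1 - ((n:ℝ)/2 + s) - 1 = -((n:ℝ)/2 + s) by ring]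
    push_cast
    ring
  · simp [cutKernel]

lemma norm_rpow_neg_two_mul {z : En n} : (‖z‖ ^ 2) ^ (-((n:ℝ)/2 + s)) = fracKernel n s z := by
  rw [fracKernel, ← Real.rpow_natCast, ← Real.rpow_mul (norm_nonneg z)]
  congr 1
  push_cast
  ring

lemma sq_add_rpow_neg_le (hs : 0 < s) {z : En n} (hz : z ≠ 0) :
    (‖z‖ ^ 2 + τ ^ 2) ^ (-((n:ℝ)/2 + s)) ≤ fracKernel n s z := by
  have := norm_pos_iff.2 hz
  rw [← norm_rpow_neg_two_mul]
  refine Real.rpow_le_rpow_of_nonpos (by positivity) (by nlinarith [sq_nonneg τ]) ?_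
  have : (0:ℝ) ≤ n := n.cast_nonneg
  linarith

lemma sq_add_rpow_one_sub_le (hn : 0 < n) (hs : 1 / 2 ≤ s) {z : En n} (hz : z ≠ 0) :
    (‖z‖ ^ 2 + τ ^ 2) ^ (1 - ((n:ℝ)/2 + s)) ≤ ‖z‖ ^ 2 * fracKernel n s z := by
  have := norm_pos_iff.2 hz
  have e : ‖z‖ ^ 2 * fracKernel n s z = (‖z‖ ^ 2) ^ (1 - ((n:ℝ)/2 + s)) := by
    rw [← norm_rpow_neg_two_mul, sub_eq_add_neg, Real.rpow_add (by positivity), Real.rpow_one]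
  rw [e]
  refine Real.rpow_le_rpow_of_nonpos (by positivity) (by nlinarith [sq_nonneg τ]) ?_
  have : (1:ℝ) ≤ n := by exact_mod_cast hn
  linarith

lemma cutKernel_nonneg (z : En n) : 0 ≤ cutKernel n s τ z := by
  unfold cutKernel; positivity

lemma cutKernel_le (hn : 0 < n) (hs : 1 / 2 ≤ s) {z : En n} (hz : z ≠ 0) (hz2 : ‖z‖ ≤ 1 / 2) :
    cutKernel n s τ z ≤ fracKernel n s z := by
  have h1 := sq_add_rpow_one_sub_le (τ := τ) hn hs hz
  have h2 := max_quarter_sub_mem z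
  have h3 : ‖z‖ ^ 2 ≤ 1 := pow_le_one₀ (norm_nonneg z) (by linarith)
  have h4 : max (1 / 4 - ‖z‖ ^ 2) 0 ^ 2 ≤ 1 := pow_le_one₀ h2.1 (by linarith [h2.2])
  have h5 := fracKernel_nonneg (s := s) z
  unfold cutKernel
  calc _ ≤ 1 * (1 * fracKernel n s z) := by
        refine mul_le_mul h4 (h1.trans ?_) (by positivity) zero_le_one
        gcongr
    _ = _ := by ring

lemma abs_cutKernelD_le (hn : 0 < n) (hs : s ∈ Ico (1 / 2 : ℝ) 1) {e : En n} (he : ‖e‖ = 1)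
    {z : En n} (hz : z ≠ 0) (hz2 : ‖z‖ ≤ 1 / 2) :
    |cutKernelD n s τ e z| ≤ (n + 2) * (‖z‖ * fracKernel n s z) := by
  have h1 := sq_add_rpow_one_sub_le (τ := τ) hn hs.1 hz
  have h1' := sq_add_rpow_neg_le (n := n) (τ := τ) (s := s) (by linarith [hs.1]) hz
  obtain ⟨h2, h3⟩ := max_quarter_sub_mem z
  have h5 := fracKernel_nonneg (s := s) z
  have h6 := abs_inner_le_norm_of_unit he z
  have hn0 : (1:ℝ) ≤ n := by exact_mod_cast hn
  have ha : |1 - ((n:ℝ)/2 + s)| ≤ n := by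
    rw [abs_le]; constructor <;> linarith [hs.1, hs.2]
  unfold cutKernelD
  refine (abs_add_le _ _).trans ?_
  have t1 : |-(4 * max (1 / 4 - ‖z‖ ^ 2) 0 * inner ℝ z e)
      * (‖z‖ ^ 2 + τ ^ 2) ^ (1 - ((n:ℝ)/2 + s))| ≤ ‖z‖ * (1 / 4 * fracKernel n s z) := by
    rw [abs_mul, abs_neg, abs_mul, abs_of_nonneg (a := 4 * max (1 / 4 - ‖z‖ ^ 2) 0)
      (by positivity), abs_of_nonneg (a := (‖z‖ ^ 2 + τ ^ 2) ^ _) (by positivity)]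
    refine mul_le_mul ?_ (h1.trans ?_) (by positivity) (norm_nonneg z)
    · calc _ ≤ 1 * ‖z‖ := mul_le_mul (by linarith) h6 (abs_nonneg _) zero_le_one
        _ = _ := one_mul _
    · exact mul_le_mul_of_nonneg_right (by nlinarith [norm_nonneg z]) h5
  have t2 : |max (1 / 4 - ‖z‖ ^ 2) 0 ^ 2 * ((1 - ((n:ℝ)/2 + s)) * (2 * inner ℝ z e)
      * (‖z‖ ^ 2 + τ ^ 2) ^ (-((n:ℝ)/2 + s)))| ≤ 1 / 16 * (n * (2 * ‖z‖) * fracKernel n s z) := by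
    rw [abs_mul, abs_mul, abs_mul, abs_mul, abs_two,
      abs_of_nonneg (a := max (1 / 4 - ‖z‖ ^ 2) 0 ^ 2)
      (by positivity), abs_of_nonneg (a := (‖z‖ ^ 2 + τ ^ 2) ^ _) (by positivity)]
    gcongr
    nlinarith
  have h7 : 0 ≤ ‖z‖ * fracKernel n s z := mul_nonneg (norm_nonneg z) h5
  nlinarith [mul_nonneg (by linarith : (0:ℝ) ≤ n) h7]

lemma integrable_of_support_ball {F : En n → ℝ} (hF : Continuous F)
    (h : ∀ z : En n, 1 / 2 ≤ ‖z‖ → F z = 0) : Integrable F :=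
  hF.integrable_of_hasCompactSupport (HasCompactSupport.of_support_subset_isCompact
    (isCompact_closedBall (0 : En n) (1 / 2)) fun z hz => by
      rw [mem_closedBall_zero_iff]
      by_contra hlt
      exact hz (h z (le_of_lt (not_le.1 hlt))))

/-- The second moment of the kernel `‖z‖^{-n-2s}` in the unit ball. -/
def secondMoment (n : ℕ) (s : ℝ) : ℝ :=
  ∫ z in {z : En n | ‖z‖ ∈ Ioc 0 1}, ‖z‖ ^ 2 * fracKernel n s z

lemma integrableOn_sq_mul_fracKernel (hn : 0 < n) (hs : s < 1) :
    IntegrableOn (fun z : En n => ‖z‖ ^ 2 * fracKernel n s z) {z : En n | ‖z‖ ∈ Ioc 0 1} :=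
  (integrableOn_shell (ρ := 1) hn (b := 2 - 2 * s) (by linarith) le_rfl).congr_fun
    (fun _ hz => (sq_mul_fracKernel (norm_pos_iff.1 hz.1)).symm)
    (measurable_norm measurableSet_Ioc)

lemma exists_cns_mul_secondMoment_le (hn : 0 < n) :
    ∃ C : ℝ, 0 < C ∧ ∀ s ∈ Ioo (0:ℝ) 1, cns n s * secondMoment n s ≤ C := by
  obtain ⟨a, A, ha, hA, h⟩ := exists_cns_bounds hn
  have hm := sphereMass_pos hn
  refine ⟨A * sphereMass n, by positivity, fun s hs => ?_⟩
  have h1 : secondMoment n s = sphereMass n * (1 / (2 - 2 * s)) := by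
    have h2 := setIntegral_shell hn (b := 2 - 2 * s) (τ := 0) (ρ := 1) (by linarith [hs.2])
      le_rfl zero_le_one
    rw [Real.one_rpow, Real.zero_rpow (by linarith [hs.2]), sub_zero] at h2
    rw [← h2, secondMoment]
    exact setIntegral_congr_fun (measurable_norm measurableSet_Ioc)
      (fun z hz => sq_mul_fracKernel (norm_pos_iff.1 hz.1))
  have hs1 : 0 < 1 - s := by linarith [hs.2]
  rw [h1]
  calc cns n s * (sphereMass n * (1 / (2 - 2 * s)))
      ≤ (A * (s * (1 - s))) * (sphereMass n * (1 / (2 - 2 * s))) := by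
        have : 0 < 2 - 2 * s := by linarith
        gcongr
        exact (h s hs).2
    _ = A * sphereMass n * (s / 2) := by
        have : 2 - 2 * s = 2 * (1 - s) := by ring
        rw [this]
        field_simp
    _ ≤ A * sphereMass n * 1 := by
        gcongr
        linarith [hs.2]
    _ = _ := mul_one _

lemma exists_le_cns_mul_integral_cutKernel (hn : 0 < n) :
    ∃ I : ℝ, 0 < I ∧ ∀ s ∈ Ico (1 / 2 : ℝ) 1, ∃ τ : ℝ, 0 < τ ∧
      I ≤ cns n s * ∫ z, cutKernel n s τ z := by
  obtain ⟨a, A, ha, hA, h⟩ := exists_cns_bounds hn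
  have hm := sphereMass_pos hn
  refine ⟨a / 4 * ((2:ℝ) ^ (-(n:ℝ)) / 64 * (sphereMass n / 8)), by positivity, fun s hs => ?_⟩
  have hs' : s ∈ Ioo (0:ℝ) 1 := ⟨by linarith [hs.1], hs.2⟩
  set b := 2 - 2 * s with hb
  have hb0 : 0 < b := by linarith [hs.2]
  have hb1 : b ≤ 1 := by linarith [hs.1]
  set τ : ℝ := (1 / 2) ^ (1 / b) * (1 / 4) with hτ
  have hτ0 : 0 < τ := by positivity
  have hτ1 : τ ≤ 1 / 4 := by
    have : (1 / 2 : ℝ) ^ (1 / b) ≤ 1 := Real.rpow_le_one (by norm_num) (by norm_num) (by positivity)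
    linarith
  have hτb : τ ^ b = 1 / 2 * (1 / 4) ^ b := by
    rw [hτ, Real.mul_rpow (by positivity) (by norm_num), ← Real.rpow_mul (by norm_num),
      one_div_mul_cancel hb0.ne', Real.rpow_one]
  refine ⟨τ, hτ0, ?_⟩
  have hint : Integrable (cutKernel n s τ) :=
    integrable_of_support_ball (continuous_cutKernel hτ0) fun z hz => cutKernel_of_half_le hz
  have h1 : ∫ z in {z : En n | ‖z‖ ∈ Ioc τ (1 / 4)}, (2:ℝ) ^ (-(n:ℝ)) / 64 * ‖z‖ ^ (b - n)
      ≤ ∫ z, cutKernel n s τ z := by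
    refine (setIntegral_mono_on ((integrableOn_shell hn hb0 hτ0.le).const_mul _)
      hint.integrableOn (measurable_norm measurableSet_Ioc) fun z hz => ?_).trans
      (setIntegral_le_integral hint (ae_of_all _ fun z => cutKernel_nonneg z))
    have hz0 : 0 < ‖z‖ := hτ0.trans hz.1
    have e1 : 1 / 64 ≤ max (1 / 4 - ‖z‖ ^ 2) 0 ^ 2 := by
      have : 1 / 8 ≤ max (1 / 4 - ‖z‖ ^ 2) 0 := le_max_of_le_left (by nlinarith [hz.2])
      nlinarith
    have e2 : (2:ℝ) ^ (-(n:ℝ)) * ‖z‖ ^ (b - n) ≤ (‖z‖ ^ 2 + τ ^ 2) ^ (1 - ((n:ℝ)/2 + s)) := by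
      have hn1 : (1:ℝ) ≤ n := by exact_mod_cast hn
      have e3 : (2 * ‖z‖ ^ 2) ^ (1 - ((n:ℝ)/2 + s)) ≤ (‖z‖ ^ 2 + τ ^ 2) ^ (1 - ((n:ℝ)/2 + s)) := by
        refine Real.rpow_le_rpow_of_nonpos (by positivity) ?_ (by linarith [hs.1])
        nlinarith [hz.1]
      refine le_trans ?_ e3
      rw [Real.mul_rpow (by norm_num) (by positivity), ← Real.rpow_natCast,
        ← Real.rpow_mul hz0.le, show ((2:ℕ):ℝ) * (1 - ((n:ℝ)/2 + s)) = b - n by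
          rw [hb]; push_cast; ring]
      gcongr
      · norm_num
      · linarith [hs.2]
    unfold cutKernel
    calc _ = 1 / 64 * ((2:ℝ) ^ (-(n:ℝ)) * ‖z‖ ^ (b - n)) := by ring
      _ ≤ _ := by gcongr
  rw [integral_const_mul, setIntegral_shell hn hb0 hτ0.le hτ1, hτb] at h1
  have h2 : 1 / 8 / b ≤ ((1 / 4) ^ b - 1 / 2 * (1 / 4 : ℝ) ^ b) / b := by
    have : (1 / 4 : ℝ) ≤ (1 / 4) ^ b := by
      simpa using Real.rpow_le_rpow_of_exponent_ge (x := (1/4 : ℝ)) (by norm_num) (by norm_num) hb1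
    gcongr
    linarith
  have h3 : a * (b / 4) ≤ cns n s := by
    refine le_trans ?_ (h s hs').1
    gcongr
    nlinarith [hs.1, hs.2]
  have hc := (cns_pos hn hs').le
  calc a / 4 * ((2:ℝ) ^ (-(n:ℝ)) / 64 * (sphereMass n / 8))
      = a * (b / 4) * ((2:ℝ) ^ (-(n:ℝ)) / 64 * (sphereMass n * (1 / 8 / b))) := by
        field_simp
    _ ≤ cns n s * ((2:ℝ) ^ (-(n:ℝ)) / 64
        * (sphereMass n * (((1 / 4) ^ b - 1 / 2 * (1 / 4 : ℝ) ^ b) / b))) := by gcongr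
    _ ≤ _ := mul_le_mul_of_nonneg_left h1 (cns_pos hn hs').le

end cut

section core

variable {n : ℕ} {s τ : ℝ}

lemma cutKernel_energy_bound (hn : 0 < n) (hs : s ∈ Ico (1 / 2 : ℝ) 1) (hτ : 0 < τ)
    {V : En n → ℝ} (hV : ContDiff ℝ (⊤ : ℕ∞) V) {e : En n} (he : ‖e‖ = 1) (x : En n)
    {G : En n → ℝ} {θ κ : ℝ} (hκ : 0 < κ) (hG : ∀ z : En n, ‖z‖ ≤ 1 → 0 ≤ G z)
    (hG' : ∀ z : En n, ‖z‖ ≤ 1 / 2 → 2 * θ - (dd n e V (x + z) + dd n e V (x - z)) ≤ G z)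
    (hint : Integrable fun z =>
      (G z + ((V (x + z) - V x) ^ 2 + (V (x - z) - V x) ^ 2)) * localKernel n s z) :
    θ * ∫ z, cutKernel n s τ z ≤ (n + 2) * (κ / 4) * secondMoment n s
      + (4 + 4 * (n + 2) / κ) * (1 / 2 * ∫ z, (G z
        + ((V (x + z) - V x) ^ 2 + (V (x - z) - V x) ^ 2)) * localKernel n s z) := by
  have hs0 : 0 < s := by linarith [hs.1]
  have hVc := hV.continuous
  have hWc := (contDiff_dd hV e).continuous
  set W := dd n e V with hW
  set q := cutKernel n s τ
  set q' := cutKernelD n s τ e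
  set k := localKernel n s
  set D : En n → ℝ := fun z => (V (x + z) - V x) ^ 2 + (V (x - z) - V x) ^ 2 with hD
  set f : En n → ℝ := fun z => V (x + z) - V (x - z) with hf
  set f' : En n → ℝ := fun z => W (x + z) + W (x - z) with hf'
  have hqc : Continuous q := continuous_cutKernel hτ
  have hq'c : Continuous q' := continuous_cutKernelD hτ e
  have hq0 : ∀ z : En n, 1 / 2 ≤ ‖z‖ → q z = 0 := fun z hz => cutKernel_of_half_le hz
  have hq'0 : ∀ z : En n, 1 / 2 ≤ ‖z‖ → q' z = 0 := fun z hz => cutKernelD_of_half_le hz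
  have hfc : Continuous f := by fun_prop
  have hf'c : Continuous f' := by fun_prop
  have i1 : Integrable fun z => f' z * q z :=
    integrable_of_support_ball (by fun_prop) fun z hz => by rw [hq0 z hz, mul_zero]
  have i2 : Integrable fun z => f z * q' z :=
    integrable_of_support_ball (by fun_prop) fun z hz => by rw [hq'0 z hz, mul_zero]
  have i3 : Integrable fun z => f z * q z :=
    integrable_of_support_ball (by fun_prop) fun z hz => by rw [hq0 z hz, mul_zero]
  have iq : Integrable q := integrable_of_support_ball hqc hq0
  have hfd : ∀ z, HasLineDerivAt ℝ f (f' z) z e := fun z => by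
    have h1 : HasDerivAt (fun t : ℝ => V (x + (z + t • e))) (W (x + z)) 0 :=
      hasLineDerivAt_const_add hV x z e
    have h2 := hasDerivAt_add_smul hV (x - z) (-e) 0
    have h3 : dd n (-e) V (x - z + (0:ℝ) • -e) = -W (x - z) := by simp [dd, hW]
    rw [h3] at h2
    refine ((h1.sub h2).congr_deriv ?_).congr_of_eventuallyEq (Eventually.of_forall fun t => ?_)
    · simp [hf']
    · simp only [hf, Pi.sub_apply, smul_neg, ← sub_eq_add_neg, sub_sub]
  have ibp := integral_mul_lineDeriv_eq i1 i2 i3 hfd fun z => hasLineDerivAt_cutKernel hτ z e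
  set J : En n → ℝ := indicator {z : En n | ‖z‖ ∈ Ioc 0 1} fun z => ‖z‖ ^ 2 * fracKernel n s z
  have hJm : MeasurableSet {z : En n | ‖z‖ ∈ Ioc 0 1} := measurable_norm measurableSet_Ioc
  have iJ : Integrable J := (integrableOn_sq_mul_fracKernel hn hs.2).integrable_indicator hJm
  have hJ : ∫ z, J z = secondMoment n s := integral_indicator hJm
  have hJ0 : ∀ z, 0 ≤ J z := fun z => indicator_nonneg
    (fun z _ => mul_nonneg (sq_nonneg _) (fracKernel_nonneg z)) z
  have hA : 0 ≤ 4 * ((n:ℝ) + 2) / κ := by positivity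
  have hne : ∀ᵐ z : En n, z ≠ 0 := by
    have : Nonempty (Fin n) := ⟨⟨0, hn⟩⟩
    exact measure_eq_zero_iff_ae_notMem.1
      (measure_singleton (0 : En n) : volume {(0 : En n)} = 0)
  have key : ∀ᵐ z : En n, 2 * θ * q z ≤ (f' z * q z + f z * q' z)
      + (n + 2) * (κ / 2) * J z + (4 + 4 * (n + 2) / κ) * ((G z + D z) * k z) := by
    filter_upwards [hne] with z hz
    have hDz : 0 ≤ D z := by positivity
    have hkz : 0 ≤ k z := localKernel_nonneg hs0 hz
    rcases le_or_gt ‖z‖ (1 / 2) with h | h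
    · have hGz := hG z (by linarith)
      have b1 : fracKernel n s z / 4 ≤ k z := quarter_fracKernel_le_localKernel hn hs0 hz h
      have b2 : q z ≤ fracKernel n s z := cutKernel_le hn hs.1 hz h
      have b3 : |q' z| ≤ (n + 2) * (‖z‖ * fracKernel n s z) := abs_cutKernelD_le hn hs he hz h
      have b4 : 0 ≤ q z := cutKernel_nonneg z
      have hk0 := fracKernel_nonneg (s := s) z
      have eJ : J z = ‖z‖ ^ 2 * fracKernel n s z :=
        indicator_of_mem (show z ∈ {z : En n | ‖z‖ ∈ Ioc 0 1} from
          ⟨norm_pos_iff.2 hz, by linarith⟩) _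
      have c1 : 2 * θ * q z ≤ f' z * q z + 4 * (G z * k z) := by
        have h1 := mul_le_mul_of_nonneg_right (hG' z h) b4
        have h2 : G z * q z ≤ G z * (4 * k z) := mul_le_mul_of_nonneg_left (by linarith) hGz
        simp only [hf']
        linarith
      have c2 : -(f z * q' z) ≤ (n + 2) * (κ / 2) * J z + 4 * (n + 2) / κ * (D z * k z) := by
        have h1 : -(f z * q' z) ≤ |f z| * ((n + 2) * (‖z‖ * fracKernel n s z)) := by
          refine (neg_le_abs _).trans ?_
          rw [abs_mul]
          exact mul_le_mul_of_nonneg_left b3 (abs_nonneg _)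
        have h2 : |f z| * ‖z‖ ≤ κ / 2 * ‖z‖ ^ 2 + 1 / (2 * κ) * f z ^ 2 := by
          rw [← sq_abs (f z)]
          have : 0 ≤ (κ * ‖z‖ - |f z|) ^ 2 / (2 * κ) := by positivity
          have e : (κ * ‖z‖ - |f z|) ^ 2 / (2 * κ)
              = κ / 2 * ‖z‖ ^ 2 + 1 / (2 * κ) * |f z| ^ 2 - |f z| * ‖z‖ := by
            field_simp
            ring
          linarith
        have h3 : f z ^ 2 ≤ 2 * D z := by
          simp only [hf, hD]
          nlinarith [sq_nonneg ((V (x + z) - V x) + (V (x - z) - V x))]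
        have h4 : 1 / (2 * κ) * f z ^ 2 ≤ 1 / κ * D z := by
          calc _ ≤ 1 / (2 * κ) * (2 * D z) := by gcongr
            _ = _ := by field_simp
        have h5 : D z * fracKernel n s z ≤ D z * (4 * k z) :=
          mul_le_mul_of_nonneg_left (by linarith) hDz
        rw [eJ]
        calc _ ≤ (n + 2) * ((|f z| * ‖z‖) * fracKernel n s z) := by linarith
          _ ≤ (n + 2) * ((κ / 2 * ‖z‖ ^ 2 + 1 / κ * D z) * fracKernel n s z) := by
            gcongr; linarith
          _ = (n + 2) * (κ / 2) * (‖z‖ ^ 2 * fracKernel n s z)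
              + (n + 2) / κ * (D z * fracKernel n s z) := by ring
          _ ≤ (n + 2) * (κ / 2) * (‖z‖ ^ 2 * fracKernel n s z)
              + (n + 2) / κ * (D z * (4 * k z)) := by gcongr
          _ = _ := by ring
      have h6 : 0 ≤ 4 * ((n:ℝ) + 2) / κ * (G z * k z) := by positivity
      have h7 : 0 ≤ D z * k z := by positivity
      linarith
    · rw [hq0 z h.le, hq'0 z h.le]
      have : 0 ≤ (G z + D z) * k z := by
        rcases le_or_gt ‖z‖ 1 with h1 | h1
        · have := hG z h1
          positivity
        · have : k z = 0 := localKernel_of_one_le h1.le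
          rw [this, mul_zero]
      have := hJ0 z
      simp only [mul_zero, zero_add, add_zero]
      positivity
  have i12 : Integrable fun z => f' z * q z + f z * q' z := i1.add i2
  have i12J : Integrable fun z => (f' z * q z + f z * q' z) + (n + 2) * (κ / 2) * J z :=
    i12.add (iJ.const_mul _)
  have iR : Integrable fun z => (4 + 4 * ((n:ℝ) + 2) / κ) * ((G z + D z) * k z) :=
    hint.const_mul _
  have hI := integral_mono_ae (iq.const_mul (2 * θ)) (i12J.add iR) key
  simp only [Pi.add_apply] at hI
  rw [integral_const_mul, integral_add i12J iR, integral_add i12 (iJ.const_mul _),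
    integral_add i1 i2, ibp, integral_const_mul, integral_const_mul, hJ] at hI
  change θ * ∫ z, q z ≤ (n + 2) * (κ / 4) * secondMoment n s
    + (4 + 4 * (n + 2) / κ) * (1 / 2 * ∫ z, (G z + D z) * k z)
  linarith

end core

section core

variable {n : ℕ} {s : ℝ}

lemma integrable_sq_mul_localKernel (hn : 0 < n) (hs : s ∈ Ioo (0:ℝ) 1) :
    Integrable fun z : En n => ‖z‖ ^ 2 * localKernel n s z :=
  integrable_mul_localKernel hn hs (by fun_prop) zero_le_one fun z _ => by
    rw [abs_of_nonneg (sq_nonneg _), one_mul]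

lemma integral_sq_mul_localKernel_le (hn : 0 < n) (hs : s ∈ Ioo (0:ℝ) 1) :
    ∫ z : En n, ‖z‖ ^ 2 * localKernel n s z ≤ secondMoment n s := by
  have hJm : MeasurableSet {z : En n | ‖z‖ ∈ Ioc 0 1} := measurable_norm measurableSet_Ioc
  rw [secondMoment, ← integral_indicator hJm]
  refine integral_mono (integrable_sq_mul_localKernel hn hs)
    ((integrableOn_sq_mul_fracKernel hn hs.2).integrable_indicator hJm) fun z => ?_
  by_cases hz : ‖z‖ ∈ Ioc 0 1
  · rw [indicator_of_mem (show z ∈ {z : En n | ‖z‖ ∈ Ioc 0 1} from hz)]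
    exact mul_le_mul_of_nonneg_left (localKernel_le z) (sq_nonneg _)
  · rw [indicator_of_notMem (show z ∉ {z : En n | ‖z‖ ∈ Ioc 0 1} from hz)]
    by_cases h0 : z = 0
    · simp [h0]
    · have : 1 ≤ ‖z‖ := by
        by_contra h
        exact hz ⟨norm_pos_iff.2 h0, by linarith⟩
      rw [localKernel_of_one_le this, mul_zero]

lemma sq_dd_le_sum (φ : En n → ℝ) {e : En n} (he : ‖e‖ = 1) (x : En n) :
    dd n e φ x ^ 2 ≤ ∑ i : Fin n, dd n (EuclideanSpace.single i 1) φ x ^ 2 := by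
  have h1 : dd n e φ x = ∑ i : Fin n, e i * dd n (EuclideanSpace.single i 1) φ x := by
    have : e = ∑ i : Fin n, e i • (EuclideanSpace.single i (1:ℝ) : En n) := by
      ext j
      simp [Pi.single_apply]
    unfold dd
    conv_lhs => rw [this]
    rw [map_sum]
    simp
  have h2 : ∑ i : Fin n, e i ^ 2 = 1 := by
    have := EuclideanSpace.norm_sq_eq e
    rw [he] at this
    simpa using this.symm
  rw [h1]
  refine (Finset.sum_mul_sq_le_sq_mul_sq _ _ _).trans ?_
  rw [h2, one_mul]

lemma negLap_energy_bound {V : En n → ℝ} (hV : ContDiff ℝ (⊤ : ℕ∞) V) {e : En n}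
    (he : ‖e‖ = 1) (x : En n) {ε : ℝ}
    (h : ∀ z : En n, ‖z‖ ≤ 1 → 0 ≤ secondDiff n (dd n e V) x z + ε * ‖z‖ ^ 2
      + 2 * V x * secondDiff n V x z - ((V (x + z) - V x) ^ 2 + (V (x - z) - V x) ^ 2)) :
    2 * dd n e V x ^ 2 ≤ negLap n (dd n e V) x + n * ε + 2 * V x * negLap n V x := by
  have hW := contDiff_dd hV e
  have hdir : ∀ i : Fin n, 2 * dd n (EuclideanSpace.single i 1) V x ^ 2 ≤
      -dd2 n (EuclideanSpace.single i 1) (dd n e V) x + ε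
      + 2 * V x * -dd2 n (EuclideanSpace.single i 1) V x := fun i => by
    set a : En n := EuclideanSpace.single i 1 with ha
    have hna : ‖a‖ = 1 := by simp [ha]
    have t1 : ∀ {φ : En n → ℝ}, ContDiff ℝ (⊤ : ℕ∞) φ → Tendsto
        (fun h : ℝ => secondDiff n φ x (h • a) / h ^ 2) (nhdsWithin 0 (Ioi 0))
        (nhds (-dd2 n a φ x)) := fun {φ} hφ => by
      have := tendsto_second_difference (hasDerivAt_add_smul hφ x a)
        (hasDerivAt_add_smul (contDiff_dd hφ a) x a 0)
      simpa [secondDiff, sub_eq_add_neg, dd2, dd] using this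
    have t2 : ∀ b : En n, Tendsto (fun h : ℝ => ((V (x + h • b) - V x) / h) ^ 2)
        (nhdsWithin 0 (Ioi 0)) (nhds (dd n b V x ^ 2)) := fun b => by
      have h1 := hasDerivAt_iff_tendsto_slope_zero.1 (hasDerivAt_add_smul hV x b 0)
      have hsub : Ioi (0:ℝ) ⊆ {0}ᶜ := fun t ht => ne_of_gt ht
      have h2 := (h1.mono_left (nhdsWithin_mono 0 hsub)).pow 2
      simpa [div_eq_inv_mul] using h2
    have t3 := t2 (-a)
    have e3 : dd n (-a) V x ^ 2 = dd n a V x ^ 2 := by simp [dd]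
    rw [e3] at t3
    have t4 := (t2 a).add t3
    have t5 := ((t1 hW).add_const ε).add ((t1 hV).const_mul (2 * V x))
    rw [two_mul (dd n a V x ^ 2)]
    refine le_of_tendsto_of_tendsto t4 t5 ?_
    filter_upwards [Ioo_mem_nhdsGT one_pos] with r hr
    have hr0 : r ≠ 0 := hr.1.ne'
    have hnr : ‖r • a‖ = r := by rw [norm_smul, hna, mul_one, Real.norm_of_nonneg hr.1.le]
    have h1 := h (r • a) (by rw [hnr]; exact hr.2.le)
    rw [hnr] at h1
    rw [smul_neg, ← sub_eq_add_neg x (r • a)]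
    have h2 := div_nonneg h1 (sq_nonneg r)
    have e4 : (secondDiff n (dd n e V) x (r • a) + ε * r ^ 2 + 2 * V x * secondDiff n V x (r • a)
        - ((V (x + r • a) - V x) ^ 2 + (V (x - r • a) - V x) ^ 2)) / r ^ 2
        = secondDiff n (dd n e V) x (r • a) / r ^ 2 + ε
          + 2 * V x * (secondDiff n V x (r • a) / r ^ 2)
          - (((V (x + r • a) - V x) / r) ^ 2 + ((V (x - r • a) - V x) / r) ^ 2) := by
      field_simp
    linarith
  have hsum := Finset.sum_le_sum fun i (_ : i ∈ Finset.univ) => hdir i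
  rw [← Finset.mul_sum, Finset.sum_add_distrib, Finset.sum_add_distrib, ← Finset.mul_sum,
    Finset.sum_neg_distrib, Finset.sum_neg_distrib] at hsum
  simp only [Finset.sum_const, Finset.card_univ, Fintype.card_fin, nsmul_eq_mul] at hsum
  have := sq_dd_le_sum V he x
  unfold negLap
  linarith

set_option maxHeartbeats 1000000 in
lemma exists_bernstein_threshold (hn : 0 < n) :
    ∃ ε ∈ Ioo (0:ℝ) (1 / 4), ∀ s ∈ Icc (0:ℝ) 1, ∀ (V : En n → ℝ) (e : En n),
      ContDiff ℝ (⊤ : ℕ∞) V → ‖e‖ = 1 → (∀ x ∈ closedBall (0 : En n) 3, |V x| ≤ ε) →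
      (∀ x ∈ closedBall (0 : En n) 3, dd n e V x ≤ 1 + ε) →
      (∀ x ∈ closedBall (0 : En n) 3, dd n e V x ≤ ε ∨
        (localOp n s (dd n e V) x + tailMass n s * dd n e V x ≤ ε ∧
          V x * localOp n s V x ≤ ε)) → dd n e V 0 ≠ 1 := by
  obtain ⟨C₁, hC₁, h₁⟩ := exists_cns_mul_secondMoment_le hn
  obtain ⟨m, hm, hm'⟩ := exists_le_cns_mul_integral_tailKernel hn
  obtain ⟨I, hI, hI'⟩ := exists_le_cns_mul_integral_cutKernel hn
  set κ := I / ((n + 2) * C₁) with hκ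
  have hκ0 : 0 < κ := by positivity
  set A := 4 + 4 * ((n:ℝ) + 2) / κ with hA
  have hA0 : 0 < A := by positivity
  obtain ⟨ε, hε0, hε⟩ : ∃ ε : ℝ, 0 < ε ∧ ε < 1 / 4 ∧ A * (3 + C₁) * ε < I / 4 ∧
      (3 + C₁) * ε < m / 2 ∧ (n + 3) * ε < 1 := by
    have h1 : ∀ᶠ ε : ℝ in nhdsWithin 0 (Ioi 0), ε < 1 / 4 ∧ A * (3 + C₁) * ε < I / 4 ∧
      (3 + C₁) * ε < m / 2 ∧ (n + 3) * ε < 1 := by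
      have aux : ∀ a b : ℝ, 0 < b → ∀ᶠ ε : ℝ in nhdsWithin 0 (Ioi 0), a * ε < b := fun a b hb => by
        have : Tendsto (fun ε : ℝ => a * ε) (nhdsWithin 0 (Ioi 0)) (nhds (a * 0)) :=
          (tendsto_id.const_mul a).mono_left nhdsWithin_le_nhds
        rw [mul_zero] at this
        exact this.eventually_lt_const hb
      filter_upwards [aux 1 (1 / 4) (by norm_num), aux (A * (3 + C₁)) (I / 4) (by positivity),
        aux (3 + C₁) (m / 2) (by positivity), aux (n + 3) 1 one_pos] with ε e1 e2 e3 e4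
      exact ⟨by linarith, e2, e3, e4⟩
    obtain ⟨ε, h2, h3⟩ := (h1.and self_mem_nhdsWithin).exists
    exact ⟨ε, h3, h2⟩
  obtain ⟨hε1, hε2, hε3, hε4⟩ := hε
  refine ⟨ε, ⟨hε0, hε1⟩, fun s hs V e hV he hVε hWε hdich h0 => ?_⟩
  have hW := contDiff_dd hV e
  set W := dd n e V with hWdef
  set Ψ : En n → ℝ := fun x => W x - ε / 2 * ‖x‖ ^ 2 + V x ^ 2 with hΨ
  have hVc := hV.continuous
  have hWc := hW.continuous
  have hΨc : Continuous Ψ := by fun_prop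
  obtain ⟨x, hx3, hmax⟩ := (isCompact_closedBall (0 : En n) 3).exists_isMaxOn
    ⟨0, by simp⟩ hΨc.continuousOn
  have hΨ0 : 1 ≤ Ψ x := by
    refine le_trans ?_ (hmax (show (0 : En n) ∈ closedBall (0 : En n) 3 by simp))
    simp only [hΨ, h0, norm_zero]
    nlinarith [sq_nonneg (V 0)]
  have hVx := hVε x hx3
  have hsq : ∀ y ∈ closedBall (0 : En n) 3, V y ^ 2 ≤ ε ^ 2 := fun y hy =>
    sq_le_sq' (abs_le.1 (hVε y hy)).1 (abs_le.1 (hVε y hy)).2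
  have hx2 : ‖x‖ < 2 := by
    by_contra h
    have h1 := hWε x hx3
    have h2 := hsq x hx3
    simp only [hΨ] at hΨ0
    have : (4:ℝ) ≤ ‖x‖ ^ 2 := by nlinarith
    nlinarith
  have hWx : 1 - ε ^ 2 ≤ W x := by
    have h2 := hsq x hx3
    simp only [hΨ] at hΨ0
    nlinarith [sq_nonneg ‖x‖]
  obtain ⟨d1, d2⟩ := (hdich x hx3).resolve_left (by nlinarith)
  have hmem : ∀ z : En n, ‖z‖ ≤ 1 → x + z ∈ closedBall (0 : En n) 3 ∧
      x - z ∈ closedBall (0 : En n) 3 := fun z hz => by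
    rw [mem_closedBall_zero_iff, mem_closedBall_zero_iff]
    exact ⟨(norm_add_le _ _).trans (by linarith), (norm_sub_le _ _).trans (by linarith)⟩
  have hSΨ : ∀ z : En n, ‖z‖ ≤ 1 → 0 ≤ secondDiff n Ψ x z := fun z hz => by
    have h1 : Ψ (x + z) ≤ Ψ x := hmax (hmem z hz).1
    have h2 : Ψ (x - z) ≤ Ψ x := hmax (hmem z hz).2
    unfold secondDiff
    linarith
  have hpar : ∀ z, ‖x + z‖ ^ 2 + ‖x - z‖ ^ 2 = 2 * ‖x‖ ^ 2 + 2 * ‖z‖ ^ 2 := fun z => by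
    have := parallelogram_law_with_norm ℝ x z
    linarith
  have hid : ∀ z, secondDiff n Ψ x z + ((V (x + z) - V x) ^ 2 + (V (x - z) - V x) ^ 2)
      = secondDiff n W x z + ε * ‖z‖ ^ 2 + 2 * V x * secondDiff n V x z := fun z => by
    simp only [secondDiff, hΨ]
    linear_combination (ε / 2) * hpar z
  by_cases hs0 : s = 0
  · simp only [localOp, tailMass, hs0, if_true] at d1
    nlinarith
  by_cases hs1 : s = 1
  · simp only [localOp, tailMass, hs1, if_true, one_ne_zero, if_false] at d1 d2
    have h1 := negLap_energy_bound hV he x (ε := ε) fun z hz => by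
      have := hSΨ z hz
      have := hid z
      linarith
    have hW8 : 7 / 8 ≤ W x := by nlinarith
    have : (49:ℝ) / 64 ≤ W x ^ 2 := by nlinarith
    rw [← hWdef] at h1
    linarith
  have hs' := mem_Ioo_of_mem_Icc hs hs0 hs1
  have hc := cns_pos hn hs'
  rw [localOp_of_mem hs', tailMass_of_mem hs'] at d1
  rw [localOp_of_mem hs'] at d2
  set c := cns n s
  set P := ∫ z, (secondDiff n Ψ x z + ((V (x + z) - V x) ^ 2 + (V (x - z) - V x) ^ 2))
    * localKernel n s z with hP
  have iW := integrable_secondDiff_mul_localKernel hn hs' hW x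
  have iV := integrable_secondDiff_mul_localKernel hn hs' hV x
  have iN := integrable_sq_mul_localKernel hn hs'
  have hfun : (fun z => (secondDiff n Ψ x z + ((V (x + z) - V x) ^ 2 + (V (x - z) - V x) ^ 2))
      * localKernel n s z) = fun z => (secondDiff n W x z * localKernel n s z
        + ε * (‖z‖ ^ 2 * localKernel n s z))
        + 2 * V x * (secondDiff n V x z * localKernel n s z) := by
    funext z
    rw [hid z]
    ring
  have iWN : Integrable fun z => secondDiff n W x z * localKernel n s z
        + ε * (‖z‖ ^ 2 * localKernel n s z) := iW.add (iN.const_mul ε)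
  have iP : Integrable fun z => (secondDiff n Ψ x z
      + ((V (x + z) - V x) ^ 2 + (V (x - z) - V x) ^ 2)) * localKernel n s z := by
    rw [hfun]
    exact iWN.add (iV.const_mul _)
  have hPeq : P = (∫ z, secondDiff n W x z * localKernel n s z)
      + ε * (∫ z : En n, ‖z‖ ^ 2 * localKernel n s z)
      + 2 * V x * ∫ z, secondDiff n V x z * localKernel n s z := by
    rw [hP, hfun, integral_add iWN (iV.const_mul _), integral_add iW (iN.const_mul ε),
      integral_const_mul, integral_const_mul]
  have hPle : c * (1 / 2 * P) ≤ (3 + C₁) * ε - c * (∫ z, tailKernel n s z) * W x := by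
    have h1 : c * ∫ z : En n, ‖z‖ ^ 2 * localKernel n s z ≤ C₁ :=
      (mul_le_mul_of_nonneg_left (integral_sq_mul_localKernel_le hn hs') hc.le).trans (h₁ s hs')
    have h2 := mul_le_mul_of_nonneg_left h1 hε0.le
    have h3 : 0 ≤ ε * C₁ := by positivity
    rw [hPeq]
    linarith
  have hW0 : 1 / 2 ≤ W x := by nlinarith
  rcases le_or_gt s (1 / 2) with hsh | hsh
  · have hP0 : 0 ≤ P := by
      refine integral_nonneg_of_ae ?_
      have : Nonempty (Fin n) := ⟨⟨0, hn⟩⟩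
      filter_upwards [measure_eq_zero_iff_ae_notMem.1
        (measure_singleton (0 : En n) : volume {(0 : En n)} = 0)] with z hz
      rcases le_or_gt ‖z‖ 1 with h1 | h1
      · have := hSΨ z h1
        have := localKernel_nonneg hs'.1 hz
        simp only [Pi.zero_apply]
        positivity
      · rw [localKernel_of_one_le h1.le, mul_zero, Pi.zero_apply]
    have h1 := hm' s hs' hsh
    have h2 : m * (1 / 2) ≤ c * (∫ z, tailKernel n s z) * W x :=
      mul_le_mul h1 hW0 (by norm_num) (by linarith)
    have h3 : 0 ≤ c * (1 / 2 * P) := by positivity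
    linarith
  · have hsI : s ∈ Ico (1 / 2 : ℝ) 1 := ⟨hsh.le, hs'.2⟩
    obtain ⟨τ, hτ, hτI⟩ := hI' s hsI
    have h1 := cutKernel_energy_bound hn hsI hτ hV he x (G := secondDiff n Ψ x)
      (θ := 1 - 2 * ε ^ 2) hκ0 hSΨ (fun z hz => by
        have hz1 : ‖z‖ ≤ 1 := by linarith
        have h1 := hsq _ (hmem z hz1).1
        have h2 := hsq _ (hmem z hz1).2
        have h3 : ε / 2 * (‖x + z‖ ^ 2 + ‖x - z‖ ^ 2) = ε / 2 * (2 * ‖x‖ ^ 2 + 2 * ‖z‖ ^ 2) := by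
          rw [hpar z]
        have h4 : 0 ≤ ε * ‖z‖ ^ 2 := by positivity
        rw [← hWdef]
        simp only [secondDiff, hΨ]
        linarith [sq_nonneg (V x)]) iP
    have h2 := mul_le_mul_of_nonneg_left h1 hc.le
    have h3 : c * ∫ z, tailKernel n s z ≥ 0 :=
      mul_nonneg hc.le (integral_nonneg fun z => (tailKernel_pos z).le)
    have h4 : c * (1 / 2 * P) ≤ (3 + C₁) * ε := by nlinarith
    have h5 : (1 - 2 * ε ^ 2) * I ≤ (1 - 2 * ε ^ 2) * (c * ∫ z, cutKernel n s τ z) :=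
      mul_le_mul_of_nonneg_left hτI (by nlinarith)
    have h6 : (n + 2) * (κ / 4) * (c * secondMoment n s) ≤ (n + 2) * (κ / 4) * C₁ :=
      mul_le_mul_of_nonneg_left (h₁ s hs') (by positivity)
    have h7 : (n + 2) * (κ / 4) * C₁ = I / 4 := by
      rw [hκ]
      field_simp
    have h8 : A * (c * (1 / 2 * P)) ≤ A * ((3 + C₁) * ε) := mul_le_mul_of_nonneg_left h4 hA0.le
    have h9 : 2 * ε ^ 2 * I ≤ 1 / 8 * I :=
      mul_le_mul_of_nonneg_right (by nlinarith only [hε0, hε1]) hI.le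
    linarith

lemma exists_fracOp_threshold (hn : 0 < n) :
    ∃ ε ∈ Ioo (0:ℝ) 1, ∀ s ∈ Icc (0:ℝ) 1, ∀ (U : En n → ℝ) (e : En n),
      ContDiff ℝ (⊤ : ℕ∞) U → ‖e‖ = 1 → (∃ M, ∀ x, |dd n e U x| ≤ M) →
      (∃ M, ∀ x, |dd n e (dd n e U) x| ≤ M) → (∀ x, |U x| ≤ ε) →
      (∀ x ∈ closedBall (0 : En n) 3, dd n e U x ≤ 1 + ε) →
      (∀ x ∈ closedBall (0 : En n) 3, dd n e U x ≤ ε ∨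
        (fracOp n s (dd n e U) x ≤ ε ∧ -ε ≤ fracOp n s U x)) → dd n e U 0 ≠ 1 := by
  obtain ⟨ε₀, ⟨hε₀, hε₁⟩, hcore⟩ := exists_bernstein_threshold hn
  obtain ⟨C₁, hC₁, hmass⟩ := exists_tailMass_le hn
  obtain ⟨C₂, hC₂, htail⟩ := exists_abs_tailOp_le hn
  have hK : 0 < 2 * (1 + C₁ + C₂) := by linarith
  set ε := ε₀ / (2 * (1 + C₁ + C₂)) with hε
  have hε0 : 0 < ε := by positivity
  have hKε : 2 * (1 + C₁ + C₂) * ε = ε₀ := by rw [hε]; field_simp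
  have e1 : 0 ≤ C₁ * ε := by positivity
  have e2 : 0 ≤ C₂ * ε := by positivity
  have hε1 : ε < 1 := by linarith
  refine ⟨ε, ⟨hε0, hε1⟩, fun s hs U e hU he hb1 hb2 hUε hWε hdich => ?_⟩
  have hW := contDiff_dd hU e
  have hV : ContDiff ℝ (⊤ : ℕ∞) fun x => U x - ε := hU.sub contDiff_const
  have hV' : ∀ x, -(2 * ε) ≤ U x - ε ∧ U x - ε ≤ 0 := fun x => by
    have := abs_le.1 (hUε x)
    constructor <;> linarith
  rw [← dd_sub_const (φ := U) ε e]
  refine hcore s hs _ e hV he (fun x _ => abs_le.2 ⟨?_, ?_⟩) (fun x hx => ?_) fun x hx => ?_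
  · linarith [(hV' x).1]
  · linarith [(hV' x).2]
  · rw [dd_sub_const]
    linarith [hWε x hx]
  · rw [dd_sub_const, localOp_sub_const]
    refine (hdich x hx).imp (fun h => by linarith) fun ⟨h1, h2⟩ => ?_
    obtain ⟨t1, t2, -⟩ := htail s hs U e ε hU he hUε hb1 hb2 x
    rw [fracOp_eq_localOp hn hs hW hb1 x] at h1
    rw [fracOp_eq_localOp hn hs hU ⟨ε, hUε⟩ x] at h2
    rw [abs_le] at t1 t2
    refine ⟨by linarith, ?_⟩
    have h3 : tailMass n s * U x ≤ C₁ * ε :=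
      (mul_le_mul_of_nonneg_left (abs_le.1 (hUε x)).2 (tailMass_nonneg hn hs)).trans
        (mul_le_mul_of_nonneg_right (hmass s hs) hε0.le)
    have h4 : -((1 + C₁ + C₂) * ε) ≤ localOp n s U x := by linarith
    have h5 : (U x - ε) * localOp n s U x ≤ (U x - ε) * -((1 + C₁ + C₂) * ε) :=
      mul_le_mul_of_nonpos_left h4 (hV' x).2
    have h6 : (ε - U x) * ((1 + C₁ + C₂) * ε) ≤ 2 * ((1 + C₁ + C₂) * ε) :=
      mul_le_mul_of_nonneg_right (by linarith [(hV' x).1]) (by positivity)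
    linarith

lemma le_add_sq_of_deriv2_le {a a' a'' : ℝ → ℝ} (ha : ∀ t, HasDerivAt a (a' t) t)
    (ha' : ∀ t, HasDerivAt a' (a'' t) t) {δ : ℝ} (hδ : 0 ≤ δ)
    (h : ∀ t ∈ Icc 0 δ, a'' t ≤ 2) : a δ ≤ a 0 + δ * a' 0 + δ ^ 2 := by
  have key : ∀ {b b' : ℝ → ℝ}, (∀ t, HasDerivAt b (b' t) t) → (∀ t ∈ Icc 0 δ, b' t ≤ 0) →
      ∀ t ∈ Icc 0 δ, b t ≤ b 0 := fun {b b'} hb hb' t ht => by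
    refine antitoneOn_of_deriv_nonpos (convex_Icc 0 δ)
      (fun t _ => (hb t).continuousAt.continuousWithinAt)
      (fun t _ => (hb t).differentiableAt.differentiableWithinAt) (fun t ht => ?_)
      ⟨le_rfl, hδ⟩ ht ht.1
    rw [(hb t).deriv]
    exact hb' t (interior_subset ht)
  have h1 : ∀ t, HasDerivAt (fun t => a' t - 2 * t) (a'' t - 2) t := fun t => by
    simpa using (ha' t).fun_sub ((hasDerivAt_id' t).const_mul 2)
  have h2 : ∀ t, HasDerivAt (fun t => a t - t * a' 0 - t ^ 2) (a' t - a' 0 - 2 * t) t := fun t => by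
    simpa using ((ha t).fun_sub ((hasDerivAt_id' t).mul_const (a' 0))).fun_sub (hasDerivAt_pow 2 t)
  have h3 := key h1 fun t ht => by linarith [h t ht]
  have h4 := key h2 (fun t ht => by linarith [h3 t ht]) δ ⟨hδ, le_rfl⟩
  linarith

lemma neg_three_mul_le_dd {U : En n → ℝ} (hU : ContDiff ℝ (⊤ : ℕ∞) U) {e : En n}
    (he : ‖e‖ = 1) {δ : ℝ} (hδ : 0 < δ) (hδ1 : δ ≤ 1) (hUδ : ∀ x, |U x| ≤ δ ^ 2)
    (h2 : ∀ x ∈ closedBall (0 : En n) 4, dd n e (dd n e U) x ≤ 2) {x : En n}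
    (hx : x ∈ closedBall (0 : En n) 3) : -(3 * δ) ≤ dd n e U x := by
  have h := le_add_sq_of_deriv2_le (hasDerivAt_add_smul hU x e)
    (hasDerivAt_add_smul (contDiff_dd hU e) x e) hδ.le fun t ht => h2 _ ?_
  · simp only [zero_smul, add_zero] at h
    have h3 := (abs_le.1 (hUδ x)).2
    have h4 := (abs_le.1 (hUδ (x + δ • e))).1
    nlinarith
  · rw [mem_closedBall_zero_iff] at hx ⊢
    refine (norm_add_le _ _).trans ?_
    rw [norm_smul, he, mul_one, Real.norm_of_nonneg ht.1]
    linarith [ht.2]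

lemma exists_fracOp_threshold_second (hn : 0 < n) :
    ∃ ε ∈ Ioo (0:ℝ) 1, ∀ s ∈ Icc (0:ℝ) 1, ∀ (U : En n → ℝ) (e : En n),
      ContDiff ℝ (⊤ : ℕ∞) U → ‖e‖ = 1 → (∃ M, ∀ x, |dd n e U x| ≤ M) →
      (∃ M, ∀ x, |dd n e (dd n e U) x| ≤ M) → (∀ x, |U x| ≤ ε) →
      (∀ x ∈ closedBall (0 : En n) 4, dd n e (dd n e U) x ≤ 1 + ε) →
      (∀ x ∈ closedBall (0 : En n) 3, dd n e (dd n e U) x ≤ ε ∨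
        (fracOp n s (dd n e (dd n e U)) x ≤ ε ∧ |fracOp n s (dd n e U) x| ≤ ε)) →
      dd n e (dd n e U) 0 ≠ 1 := by
  obtain ⟨ε₀, ⟨hε₀, hε₁⟩, hcore⟩ := exists_bernstein_threshold hn
  obtain ⟨C₁, hC₁, hmass⟩ := exists_tailMass_le hn
  obtain ⟨C₂, hC₂, htail⟩ := exists_abs_tailOp_le hn
  have hK : 0 < 3 * (1 + 3 * C₁ + C₂) := by linarith
  set δ := ε₀ / (3 * (1 + 3 * C₁ + C₂)) with hδ
  have hδ0 : 0 < δ := by positivity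
  have hKδ : 3 * (1 + 3 * C₁ + C₂) * δ = ε₀ := by rw [hδ]; field_simp
  have e1 : 0 ≤ C₁ * δ := by positivity
  have e2 : 0 ≤ C₂ * δ := by positivity
  have hδ1 : δ < 1 := by linarith
  have hδδ : δ ^ 2 ≤ δ := by nlinarith
  have hδδ' : C₂ * δ ^ 2 ≤ C₂ * δ := mul_le_mul_of_nonneg_left hδδ hC₂.le
  refine ⟨δ ^ 2, ⟨by positivity, by linarith⟩, fun s hs U e hU he hb1 hb2 hUε hWε hdich => ?_⟩
  have hV := contDiff_dd hU e
  have hW := contDiff_dd hV e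
  have hW2 : ∀ x ∈ closedBall (0 : En n) 4, dd n e (dd n e U) x ≤ 2 := fun x hx => by
    linarith [hWε x hx]
  have hVδ : ∀ x ∈ closedBall (0 : En n) 3, |dd n e U x| ≤ 3 * δ := fun x hx => by
    refine abs_le.2 ⟨neg_three_mul_le_dd hU he hδ0 hδ1.le hUε hW2 hx, ?_⟩
    have hneg : ∀ φ : En n → ℝ, dd n (-e) φ = fun x => -dd n e φ x := fun φ => by
      funext y
      simp [dd]
    have hneg2 : dd n (-e) (dd n (-e) U) = dd n e (dd n e U) := by
      funext y
      rw [hneg U, hneg]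
      change -(fderiv ℝ (fun x => -dd n e U x) y e) = _
      rw [fderiv_fun_neg]
      exact neg_neg _
    have := neg_three_mul_le_dd hU (by rwa [norm_neg]) hδ0 hδ1.le hUε (e := -e)
      (by rwa [hneg2]) hx
    rw [hneg] at this
    linarith
  refine hcore s hs _ e hV he (fun x hx => (hVδ x hx).trans (by linarith))
    (fun x hx => (hWε x (closedBall_subset_closedBall (by norm_num) hx)).trans (by linarith))
    fun x hx => ?_
  refine (hdich x hx).imp (fun h => by linarith) fun ⟨h1, h2⟩ => ?_
  obtain ⟨-, t2, t3⟩ := htail s hs U e _ hU he hUε hb1 hb2 x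
  rw [fracOp_eq_localOp hn hs hW hb2 x] at h1
  rw [fracOp_eq_localOp hn hs hV hb1 x] at h2
  rw [abs_le] at t2 t3 h2
  refine ⟨by linarith, ?_⟩
  have h3 : |tailMass n s * dd n e U x| ≤ C₁ * (3 * δ) := by
    rw [abs_mul, abs_of_nonneg (tailMass_nonneg hn hs)]
    exact mul_le_mul (hmass s hs) (hVδ x hx) (abs_nonneg _) (by linarith)
  rw [abs_le] at h3
  have h4 : |localOp n s (dd n e U) x| ≤ (1 + 3 * C₁ + C₂) * δ :=
    abs_le.2 ⟨by linarith, by linarith⟩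
  calc dd n e U x * localOp n s (dd n e U) x ≤ |dd n e U x| * |localOp n s (dd n e U) x| := by
        rw [← abs_mul]
        exact le_abs_self _
    _ ≤ 3 * δ * ((1 + 3 * C₁ + C₂) * δ) := mul_le_mul (hVδ x hx) h4 (abs_nonneg _) (by linarith)
    _ ≤ ε₀ := by nlinarith

end core

section scaling

variable {n : ℕ} {s : ℝ}

lemma exists_almost_max {w : En n → ℝ} (hw : Continuous w) {j : ℕ} (hj : j ≠ 0) {κ ε : ℝ}
    (hκ : κ ∈ Ioo (0:ℝ) 1) (hε : 0 ≤ ε) (hκε : 1 ≤ (1 + ε) * (1 - κ) ^ j) {x : En n}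
    (hx : x ∈ ball (0 : En n) (1 / 2)) (hwx : 0 < w x) :
    ∃ (x₀ : En n) (r : ℝ), 0 < r ∧ r ≤ 1 ∧ 0 < w x₀ ∧ (κ / 8) ^ j * w x ≤ r ^ j * w x₀ ∧
      ∀ y ∈ closedBall (0 : En n) 4, x₀ + r • y ∈ ball (0 : En n) 1 ∧
        w (x₀ + r • y) ≤ (1 + ε) * w x₀ := by
  obtain ⟨hκ0, hκ1⟩ := hκ
  have hF : Continuous fun y : En n => (1 - ‖y‖) ^ j * w y := by fun_prop
  obtain ⟨x₀, hx₀, hmax⟩ := (isCompact_closedBall (0 : En n) 1).exists_isMaxOn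
    ⟨0, by simp⟩ hF.continuousOn
  rw [mem_ball_zero_iff] at hx
  rw [mem_closedBall_zero_iff] at hx₀
  have h1 : (1 / 2) ^ j * w x ≤ (1 - ‖x₀‖) ^ j * w x₀ := by
    refine le_trans ?_ (hmax (show x ∈ closedBall (0 : En n) 1 by
      rw [mem_closedBall_zero_iff]; linarith))
    exact mul_le_mul_of_nonneg_right (pow_le_pow_left₀ (by norm_num) (by linarith) j) hwx.le
  have h2 : 0 < (1 - ‖x₀‖) ^ j * w x₀ := lt_of_lt_of_le (by positivity) h1
  set d := 1 - ‖x₀‖ with hd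
  have hd0 : 0 < d := by
    refine lt_of_le_of_ne (by linarith) fun h => ?_
    rw [← h, zero_pow hj, zero_mul] at h2
    exact lt_irrefl _ h2
  have hd1 : d ≤ 1 := by linarith [norm_nonneg x₀]
  have hp : 0 < w x₀ := pos_of_mul_pos_right h2 (by positivity)
  refine ⟨x₀, κ * d / 4, by positivity, by nlinarith, hp, ?_, fun y hy => ?_⟩
  · have := mul_le_mul_of_nonneg_left h1 (show 0 ≤ (κ / 4) ^ j by positivity)
    rw [← mul_assoc, ← mul_assoc, ← mul_pow, ← mul_pow] at this
    rwa [show κ / 8 = κ / 4 * (1 / 2) by ring, show κ * d / 4 = κ / 4 * d by ring]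
  · rw [mem_closedBall_zero_iff] at hy
    have h3 : ‖x₀ + (κ * d / 4) • y‖ ≤ ‖x₀‖ + κ * d := by
      refine (norm_add_le _ _).trans (add_le_add_right ?_ _)
      rw [norm_smul, Real.norm_of_nonneg (by positivity)]
      have : 0 < κ * d := by positivity
      nlinarith
    set z := x₀ + (κ * d / 4) • y
    have h4 : (1 - κ) * d ≤ 1 - ‖z‖ := by linarith
    have h5 : 0 < (1 - κ) * d := mul_pos (by linarith) hd0
    refine ⟨by rw [mem_ball_zero_iff]; linarith, ?_⟩
    rcases le_or_gt (w z) 0 with h6 | h6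
    · exact h6.trans (by positivity)
    · have h7 : ((1 - κ) * d) ^ j * w z ≤ d ^ j * w x₀ := by
        refine le_trans ?_ (hmax (show z ∈ closedBall (0 : En n) 1 by
          rw [mem_closedBall_zero_iff]; linarith))
        exact mul_le_mul_of_nonneg_right (pow_le_pow_left₀ h5.le h4 j) h6.le
      have h8 : (1 - κ) ^ j * w z ≤ w x₀ := by
        rw [mul_pow, mul_comm _ (d ^ j), mul_assoc] at h7
        exact le_of_mul_le_mul_left h7 (by positivity)
      calc w z = 1 * w z := (one_mul _).symm
        _ ≤ (1 + ε) * (1 - κ) ^ j * w z := mul_le_mul_of_nonneg_right hκε h6.le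
        _ = (1 + ε) * ((1 - κ) ^ j * w z) := mul_assoc _ _ _
        _ ≤ (1 + ε) * w x₀ := mul_le_mul_of_nonneg_left h8 (by linarith)

lemma abs_deriv_le_of_touching {F φ : ℝ → ℝ} {F' L : ℝ} (hF : HasDerivAt F F' 0)
    (h0 : F 0 = φ 0) (hle : ∀ᶠ t in nhds 0, F t ≤ φ t)
    (hL : ∀ᶠ t in nhds 0, |φ t - φ 0| ≤ L * |t|) : |F'| ≤ L := by
  have key : ∀ {F : ℝ → ℝ} {F' : ℝ}, HasDerivAt F F' 0 →
      (∀ᶠ t in nhds 0, F t - F 0 ≤ L * |t|) → F' ≤ L := fun {F F'} hF h => by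
    have h1 := hF.tendsto_slope_zero_right
    refine le_of_tendsto h1 ?_
    filter_upwards [h.filter_mono nhdsWithin_le_nhds, self_mem_nhdsWithin] with t ht ht0
    have ht0' : 0 < t := ht0
    rw [abs_of_pos ht0'] at ht
    rw [zero_add, smul_eq_mul, inv_mul_le_iff₀ ht0']
    linarith
  have hb : ∀ᶠ t in nhds 0, F t - F 0 ≤ L * |t| := by
    filter_upwards [hle, hL] with t h1 h2
    rw [h0]
    linarith [le_abs_self (φ t - φ 0)]
  have h3 : HasDerivAt (fun t => F (-t)) (-F') 0 := by
    have : HasDerivAt F F' (-0) := by rwa [neg_zero]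
    simpa [Function.comp_def] using this.scomp (0:ℝ) (hasDerivAt_neg (0:ℝ))
  have hneg : Tendsto (fun t : ℝ => -t) (nhds 0) (nhds 0) := by
    simpa using (continuous_neg (G := ℝ)).tendsto 0
  refine abs_le.2 ⟨?_, key hF hb⟩
  have := key h3 (by simpa using hneg.eventually hb)
  linarith

lemma deriv2_le_of_touching {F F' φ : ℝ → ℝ} {F'' Q : ℝ} (hF : ∀ t, HasDerivAt F (F' t) t)
    (hF' : HasDerivAt F' F'' 0) (h0 : F 0 = φ 0) (hle : ∀ᶠ t in nhds 0, F t ≤ φ t)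
    (hQ : ∀ᶠ t in nhds 0, φ t + φ (-t) - 2 * φ 0 ≤ Q * t ^ 2) : F'' ≤ Q := by
  have hneg : Tendsto (fun t : ℝ => -t) (nhds 0) (nhds 0) := by
    simpa using (continuous_neg (G := ℝ)).tendsto 0
  have h1 : -Q ≤ -F'' := by
    refine ge_of_tendsto (tendsto_second_difference hF hF') ?_
    filter_upwards [hle.filter_mono nhdsWithin_le_nhds,
      (hneg.eventually hle).filter_mono nhdsWithin_le_nhds, hQ.filter_mono nhdsWithin_le_nhds,
      self_mem_nhdsWithin] with t e1 e2 e3 ht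
    have ht0 : 0 < t := ht
    rw [le_div_iff₀ (by positivity)]
    linarith
  linarith

lemma exists_neg_le_fracOp (hn : 0 < n) :
    ∃ C : ℝ, 0 < C ∧ ∀ s ∈ Icc (0:ℝ) 1, ∀ (u : En n → ℝ) (M : ℝ),
      ContDiff ℝ (⊤ : ℕ∞) u → (∀ x, |u x| ≤ M) →
      ∃ x ∈ ball (0 : En n) 1, -(C * M) ≤ fracOp n s u x := by
  obtain ⟨C₁, hC₁, h₁⟩ := exists_cns_mul_secondMoment_le hn
  obtain ⟨C₂, hC₂, h₂⟩ := exists_cns_mul_integral_tailKernel_le hn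
  refine ⟨1 + 24 * n + 12 * (C₁ + C₂), by positivity, fun s hs u M hu hM => ?_⟩
  have hM0 : 0 ≤ M := (abs_nonneg _).trans (hM 0)
  set b : En n → ℝ := fun x => min (12 * ‖x‖ ^ 2) 3 with hb
  have huc := hu.continuous
  have hbc : Continuous fun x => u x - M * b x := by fun_prop
  obtain ⟨x, hx, hmax⟩ := (isCompact_closedBall (0 : En n) (1 / 2)).exists_isMaxOn
    ⟨0, by simp⟩ hbc.continuousOn
  rw [mem_closedBall_zero_iff] at hx
  have hgl : ∀ y, u y - M * b y ≤ u x - M * b x := fun y => by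
    rcases le_or_gt ‖y‖ (1 / 2) with hy | hy
    · exact hmax (show y ∈ closedBall (0 : En n) (1 / 2) by rwa [mem_closedBall_zero_iff])
    · refine le_trans ?_ (hmax (show (0 : En n) ∈ closedBall (0 : En n) (1 / 2) by simp))
      have e1 : b y = 3 := min_eq_right (by nlinarith)
      have e2 : b 0 = 0 := by simp [hb]
      simp only [e1, e2]
      linarith [(abs_le.1 (hM y)).2, (abs_le.1 (hM 0)).1]
  have hbx : b x = 12 * ‖x‖ ^ 2 := min_eq_left (by nlinarith [norm_nonneg x])
  have hS : ∀ z, -(24 * M * min 1 (‖z‖ ^ 2)) ≤ secondDiff n u x z := fun z => by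
    have h1 := hgl (x + z)
    have h2 := hgl (x - z)
    have h3 : b (x + z) + b (x - z) - 2 * b x ≤ 24 * min 1 (‖z‖ ^ 2) := by
      rw [mul_min_of_nonneg _ _ (by norm_num : (0:ℝ) ≤ 24)]
      refine le_min ?_ ?_
      · have := min_le_right (12 * ‖x + z‖ ^ 2) 3
        have := min_le_right (12 * ‖x - z‖ ^ 2) 3
        have : 0 ≤ b x := by rw [hbx]; positivity
        simp only [hb] at *
        linarith
      · have := min_le_left (12 * ‖x + z‖ ^ 2) 3
        have := min_le_left (12 * ‖x - z‖ ^ 2) 3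
        have := parallelogram_law_with_norm ℝ x z
        rw [hbx]
        simp only [hb]
        linarith
    have h4 := mul_le_mul_of_nonneg_left h3 hM0
    unfold secondDiff
    linarith
  refine ⟨x, by rw [mem_ball_zero_iff]; linarith, ?_⟩
  have p1 : 0 ≤ (n:ℝ) * M := by positivity
  have p2 : 0 ≤ (C₁ + C₂) * M := by positivity
  by_cases h0 : s = 0
  · simp only [fracOp, h0, if_true]
    linarith [(abs_le.1 (hM x)).1]
  by_cases h1 : s = 1
  · simp only [fracOp, h1, if_true, one_ne_zero, if_false, negLap]
    have hi : ∀ i : Fin n, dd2 n (EuclideanSpace.single i 1) u x ≤ 24 * M := fun i => by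
      set a : En n := EuclideanSpace.single i 1 with ha
      have hna : ‖a‖ = 1 := by simp [ha]
      have h := ge_of_tendsto (b := -(24 * M)) (tendsto_second_difference
        (hasDerivAt_add_smul hu x a) (hasDerivAt_add_smul (contDiff_dd hu a) x a 0)) ?_
      · simp only [zero_smul, add_zero] at h
        exact neg_le_neg_iff.1 h
      · filter_upwards [self_mem_nhdsWithin] with t ht
        have ht0 : 0 < t := ht
        have h2 := hS (t • a)
        rw [norm_smul, hna, mul_one, Real.norm_of_nonneg ht0.le, secondDiff] at h2
        have h3 : 24 * M * min 1 (t ^ 2) ≤ 24 * M * t ^ 2 :=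
          mul_le_mul_of_nonneg_left (min_le_right _ _) (by positivity)
        rw [le_div_iff₀ (by positivity), zero_smul, add_zero, neg_smul, ← sub_eq_add_neg]
        linarith
    have h2 := Finset.sum_le_sum fun i (_ : i ∈ Finset.univ) => hi i
    simp only [Finset.sum_const, Finset.card_univ, Fintype.card_fin, nsmul_eq_mul] at h2
    linarith
  have hs' := mem_Ioo_of_mem_Icc hs h0 h1
  have hc := cns_pos hn hs'
  rw [fracOp_of_mem hs']
  have iF := integrable_secondDiff_mul_fracKernel hn hs' hu ⟨M, hM⟩ x
  have iL := integrable_sq_mul_localKernel hn hs'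
  have iT : Integrable (tailKernel n s) := integrable_tailKernel hn hs'.1
  have h3 : -(24 * M) * ((∫ z : En n, ‖z‖ ^ 2 * localKernel n s z) + ∫ z, tailKernel n s z)
      ≤ ∫ z, secondDiff n u x z * fracKernel n s z := by
    rw [← integral_add iL iT, ← integral_const_mul]
    refine integral_mono ((iL.add iT).const_mul _) iF fun z => ?_
    have hk := fracKernel_nonneg (n := n) (s := s) z
    have e1 := mul_le_mul_of_nonneg_right (hS z) hk
    have e2 : min 1 (‖z‖ ^ 2) * fracKernel n s z ≤
        ‖z‖ ^ 2 * localKernel n s z + tailKernel n s z := by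
      by_cases hz : z = 0
      · simp [hz, (tailKernel_pos (n := n) (s := s) 0).le]
      · have k1 := mul_le_mul_of_nonneg_right (min_le_right 1 (‖z‖ ^ 2))
          (localKernel_nonneg hs'.1 hz)
        have k2 := mul_le_mul_of_nonneg_right (min_le_left 1 (‖z‖ ^ 2))
          (tailKernel_pos (n := n) (s := s) z).le
        have k3 : fracKernel n s z = localKernel n s z + tailKernel n s z := by
          rw [localKernel, sub_add_cancel]
        rw [k3]
        linarith
    have e3 := mul_le_mul_of_nonneg_left e2 (show 0 ≤ 24 * M by positivity)
    simp only
    linarith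
  have h4 : cns n s * ∫ z : En n, ‖z‖ ^ 2 * localKernel n s z ≤ C₁ :=
    (mul_le_mul_of_nonneg_left (integral_sq_mul_localKernel_le hn hs') hc.le).trans (h₁ s hs')
  have h5 := mul_le_mul_of_nonneg_left h3 hc.le
  have h6 := mul_le_mul_of_nonneg_left (add_le_add h4 (h₂ s hs')) hM0
  linarith

end scaling

section estimates

variable {n : ℕ} {s : ℝ}

lemma eventually_add_smul_mem_ball {x : En n} (hx : x ∈ ball (0 : En n) 1) (e : En n) :
    ∀ᶠ t : ℝ in nhds 0, x + t • e ∈ ball (0 : En n) 1 := by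
  have hc : Continuous fun t : ℝ => x + t • e := by fun_prop
  exact hc.continuousAt.eventually_mem (isOpen_ball.mem_nhds (by simpa using hx))

lemma abs_deriv_line_le {F : En n → ℝ} {φ : En n → ℝ} {F' L : ℝ} {x e : En n}
    (hx : x ∈ ball (0 : En n) 1) (hF : HasDerivAt (fun t : ℝ => F (x + t • e)) F' 0)
    (h0 : F x = φ x) (hle : ∀ y ∈ ball (0 : En n) 1, F y ≤ φ y)
    (hL : ∀ x ∈ ball (0 : En n) 1, ∀ h : ℝ, x + h • e ∈ ball (0 : En n) 1 →
      |φ (x + h • e) - φ x| ≤ L * |h|) : |F'| ≤ L := by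
  refine abs_deriv_le_of_touching (φ := fun t : ℝ => φ (x + t • e)) hF (by simpa using h0) ?_ ?_
  · filter_upwards [eventually_add_smul_mem_ball hx e] with t ht using hle _ ht
  · filter_upwards [eventually_add_smul_mem_ball hx e] with t ht
    simpa using hL x hx t ht

lemma deriv2_line_le {F φ : En n → ℝ} {F' : ℝ → ℝ} {F'' Q : ℝ} {x e : En n}
    (hx : x ∈ ball (0 : En n) 1) (hF : ∀ t, HasDerivAt (fun t : ℝ => F (x + t • e)) (F' t) t)
    (hF' : HasDerivAt F' F'' 0) (h0 : F x = φ x) (hle : ∀ y ∈ ball (0 : En n) 1, F y ≤ φ y)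
    (hQ : ∀ x ∈ ball (0 : En n) 1, ∀ h : ℝ,
      x + h • e ∈ ball (0 : En n) 1 → x - h • e ∈ ball (0 : En n) 1 →
      φ (x + h • e) + φ (x - h • e) - 2 * φ x ≤ Q * h ^ 2) : F'' ≤ Q := by
  refine deriv2_le_of_touching (φ := fun t : ℝ => φ (x + t • e)) hF hF' (by simpa using h0) ?_ ?_
  · filter_upwards [eventually_add_smul_mem_ball hx e] with t ht using hle _ ht
  · filter_upwards [eventually_add_smul_mem_ball hx e,
      eventually_add_smul_mem_ball hx (-e)] with t ht ht'
    rw [smul_neg, ← sub_eq_add_neg] at ht'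
    simpa [sub_eq_add_neg] using hQ x hx t ht (by simpa using ht')

/-- A smooth bounded solution of the obstacle problem `max {(-Δ)^s u, u - g} = f` in the unit
ball, together with bounds for its first two derivatives in the direction `e`. -/
structure ObstacleSolution (n : ℕ) (s : ℝ) (e : En n) (f g u : En n → ℝ) (M : ℝ) : Prop where
  smooth : ContDiff ℝ (⊤ : ℕ∞) u
  abs_le : ∀ x, |u x| ≤ M
  dd_bdd : ∃ M', ∀ x, |dd n e u x| ≤ M'
  dd2_bdd : ∃ M', ∀ x, |dd n e (dd n e u) x| ≤ M'
  le_force : ∀ x ∈ ball (0 : En n) 1, fracOp n s u x ≤ f x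
  le_obstacle : ∀ x ∈ ball (0 : En n) 1, u x ≤ g x + f x
  eq_or_eq : ∀ x ∈ ball (0 : En n) 1, fracOp n s u x = f x ∨ u x = g x + f x

namespace ObstacleSolution

variable {e : En n} {f g u : En n → ℝ} {M : ℝ}

lemma nonneg (h : ObstacleSolution n s e f g u M) : 0 ≤ M := (abs_nonneg _).trans (h.abs_le 0)

lemma dd_dichotomy (h : ObstacleSolution n s e f g u M) (hn : 0 < n) (hs : s ∈ Icc (0:ℝ) 1)
    {Lf Lg : ℝ}
    (hf : ∀ x ∈ ball (0 : En n) 1, ∀ h : ℝ, x + h • e ∈ ball (0 : En n) 1 →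
      |f (x + h • e) - f x| ≤ Lf * |h|)
    (hg : ∀ x ∈ ball (0 : En n) 1, ∀ h : ℝ, x + h • e ∈ ball (0 : En n) 1 →
      |g (x + h • e) - g x| ≤ Lg * |h|) {x : En n} (hx : x ∈ ball (0 : En n) 1) :
    dd n e u x ≤ Lf + Lg ∨ (|fracOp n s (dd n e u) x| ≤ Lf ∧ fracOp n s u x = f x) := by
  rcases h.eq_or_eq x hx with h1 | h1
  · refine .inr ⟨?_, h1⟩
    have h2 := hasDerivAt_fracOp hn hs h.smooth ⟨M, h.abs_le⟩ h.dd_bdd x 0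
    rw [zero_smul, add_zero] at h2
    exact abs_deriv_line_le hx h2 h1 h.le_force hf
  · refine .inl ?_
    have h2 := hasDerivAt_add_smul h.smooth x e 0
    rw [zero_smul, add_zero] at h2
    refine (le_abs_self _).trans
      (abs_deriv_line_le (φ := fun x => g x + f x) hx h2 h1 h.le_obstacle fun y hy t ht => ?_)
    have := abs_add_le (f (y + t • e) - f y) (g (y + t • e) - g y)
    rw [show g (y + t • e) + f (y + t • e) - (g y + f y)
      = f (y + t • e) - f y + (g (y + t • e) - g y) by ring]
    linarith [hf y hy t ht, hg y hy t ht]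

lemma dd_dd_dichotomy (h : ObstacleSolution n s e f g u M) (hn : 0 < n) (hs : s ∈ Icc (0:ℝ) 1)
    {Lf Qf Qg : ℝ}
    (hf : ∀ x ∈ ball (0 : En n) 1, ∀ h : ℝ, x + h • e ∈ ball (0 : En n) 1 →
      |f (x + h • e) - f x| ≤ Lf * |h|)
    (hf2 : ∀ x ∈ ball (0 : En n) 1, ∀ h : ℝ,
      x + h • e ∈ ball (0 : En n) 1 → x - h • e ∈ ball (0 : En n) 1 →
      f (x + h • e) + f (x - h • e) - 2 * f x ≤ Qf * h ^ 2)
    (hg2 : ∀ x ∈ ball (0 : En n) 1, ∀ h : ℝ,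
      x + h • e ∈ ball (0 : En n) 1 → x - h • e ∈ ball (0 : En n) 1 →
      g (x + h • e) + g (x - h • e) - 2 * g x ≤ Qg * h ^ 2)
    {x : En n} (hx : x ∈ ball (0 : En n) 1) :
    dd n e (dd n e u) x ≤ Qf + Qg ∨
      (fracOp n s (dd n e (dd n e u)) x ≤ Qf ∧ |fracOp n s (dd n e u) x| ≤ Lf) := by
  have hV := contDiff_dd h.smooth e
  rcases h.eq_or_eq x hx with h1 | h1
  · have h2 := hasDerivAt_fracOp hn hs h.smooth ⟨M, h.abs_le⟩ h.dd_bdd x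
    have h3 := hasDerivAt_fracOp hn hs hV h.dd_bdd h.dd2_bdd x 0
    rw [zero_smul, add_zero] at h3
    refine .inr ⟨deriv2_line_le hx h2 h3 h1 h.le_force hf2, ?_⟩
    have h4 := h2 0
    rw [zero_smul, add_zero] at h4
    exact abs_deriv_line_le hx h4 h1 h.le_force hf
  · have h2 := hasDerivAt_add_smul hV x e 0
    rw [zero_smul, add_zero] at h2
    refine .inl (deriv2_line_le (φ := fun x => g x + f x) hx (hasDerivAt_add_smul h.smooth x e)
      h2 h1 h.le_obstacle fun y hy t ht ht' => ?_)
    linarith [hf2 y hy t ht ht', hg2 y hy t ht ht']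

end ObstacleSolution

lemma exists_dd_le (hn : 0 < n) :
    ∃ C : ℝ, 0 < C ∧ ∀ s ∈ Icc (0:ℝ) 1, ∀ (e : En n) (f g u : En n → ℝ) (M Lf Lg : ℝ),
      ‖e‖ = 1 → ObstacleSolution n s e f g u M → 0 ≤ Lf → 0 ≤ Lg →
      (∀ x ∈ ball (0 : En n) 1, ∀ y ∈ ball (0 : En n) 1, |f x - f y| ≤ Lf * dist x y) →
      (∀ x ∈ ball (0 : En n) 1, ∀ y ∈ ball (0 : En n) 1, |g x - g y| ≤ Lg * dist x y) →
      ∀ x ∈ ball (0 : En n) (1 / 2), dd n e u x ≤ C * (M + Lf + Lg) := by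
  obtain ⟨K, hK, hlow⟩ := exists_neg_le_fracOp hn
  obtain ⟨ε, ⟨hε0, hε1⟩, hcore⟩ := exists_fracOp_threshold hn
  have hC : 0 < 32 * (K + 2) / ε ^ 2 := by positivity
  refine ⟨32 * (K + 2) / ε ^ 2, hC, fun s hs e f g u M Lf Lg he h hLf hLg hf hg x hx => ?_⟩
  by_contra! hlt
  have hM := h.nonneg
  have hu := h.smooth
  have hline : ∀ {φ : En n → ℝ} {L : ℝ},
      (∀ x ∈ ball (0 : En n) 1, ∀ y ∈ ball (0 : En n) 1, |φ x - φ y| ≤ L * dist x y) →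
      ∀ x ∈ ball (0 : En n) 1, ∀ h : ℝ, x + h • e ∈ ball (0 : En n) 1 →
        |φ (x + h • e) - φ x| ≤ L * |h| := fun hφ x hx h hxh => by
    simpa [norm_smul, he] using hφ _ hxh x hx
  have hflow : ∀ y ∈ ball (0 : En n) 1, -(K * M + 2 * Lf) ≤ f y := fun y hy => by
    obtain ⟨z, hz, hz'⟩ := hlow s hs u M hu h.abs_le
    have h1 := h.le_force z hz
    have h2 := (abs_le.1 (hf y hy z hz)).1
    have h3 : dist y z ≤ 2 := (dist_triangle_right y z 0).trans
      (by linarith [mem_ball.1 hy, mem_ball.1 hz])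
    have h4 := mul_le_mul_of_nonneg_left h3 hLf
    linarith
  set S := M + Lf + Lg with hS
  have hS0 : 0 ≤ S := by positivity
  obtain ⟨x₀, r, hr0, hr1, hp, hrp, hpt⟩ := exists_almost_max (contDiff_dd hu e).continuous
    one_ne_zero (κ := ε / 4) ⟨by positivity, by linarith⟩ hε0.le (by nlinarith) hx
    (lt_of_le_of_lt (by positivity) hlt)
  rw [pow_one, pow_one] at hrp
  set p := dd n e u x₀ with hpdef
  have hbig : (K + 2) * S ≤ ε * (r * p) := by
    have h1 : ε / 4 / 8 * (32 * (K + 2) / ε ^ 2 * S) ≤ r * p :=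
      (mul_le_mul_of_nonneg_left hlt.le (by positivity)).trans hrp
    have h2 := mul_le_mul_of_nonneg_left h1 hε0.le
    refine le_trans (le_of_eq ?_) h2
    field_simp
    ring
  have hrp0 : 0 < r * p := by positivity
  have hrpp : ε * (r * p) ≤ ε * p := mul_le_mul_of_nonneg_left (by nlinarith) hε0.le
  have hKS : 0 ≤ K * S := by positivity
  have hr2 : r ^ (2 * s) ≤ 1 := Real.rpow_le_one hr0.le hr1 (by linarith [hs.1])
  have hr20 : 0 ≤ r ^ (2 * s) := Real.rpow_nonneg hr0.le _
  set U : En n → ℝ := fun y => (r * p)⁻¹ * u (x₀ + r • y) with hU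
  have hdU : dd n e U = fun y => p⁻¹ * dd n e u (x₀ + r • y) := by
    funext y
    rw [hU, dd_const_mul_comp hu]
    field_simp
  have hddU : dd n e (dd n e U) = fun y => p⁻¹ * r * dd n e (dd n e u) (x₀ + r • y) := by
    rw [hdU]
    funext y
    rw [dd_const_mul_comp (contDiff_dd hu e)]
  obtain ⟨M₁, hM₁⟩ := h.dd_bdd
  obtain ⟨M₂, hM₂⟩ := h.dd2_bdd
  refine hcore s hs U e (contDiff_const_mul_comp hu _ _ _) he ⟨|p⁻¹| * M₁, fun y => ?_⟩
    ⟨|p⁻¹ * r| * M₂, fun y => ?_⟩ (fun y => ?_) (fun y hy => ?_) (fun y hy => ?_) ?_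
  · rw [hdU, abs_mul]
    exact mul_le_mul_of_nonneg_left (hM₁ _) (abs_nonneg _)
  · rw [hddU, abs_mul]
    exact mul_le_mul_of_nonneg_left (hM₂ _) (abs_nonneg _)
  · rw [hU, abs_mul, abs_of_pos (inv_pos.2 hrp0), inv_mul_le_iff₀ hrp0]
    linarith [h.abs_le (x₀ + r • y)]
  · simp only [hdU]
    rw [inv_mul_le_iff₀ hp]
    linarith [(hpt y (closedBall_subset_closedBall (by norm_num) hy)).2]
  · have hz := (hpt y (closedBall_subset_closedBall (by norm_num) hy)).1
    refine (h.dd_dichotomy hn hs (hline hf) (hline hg) hz).imp (fun h1 => ?_) fun ⟨h1, h2⟩ => ?_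
    · simp only [hdU]
      rw [inv_mul_le_iff₀ hp]
      linarith
    · constructor
      · rw [hdU, fracOp_const_mul_comp hs (contDiff_dd hu e) _ hr0, mul_assoc,
          inv_mul_le_iff₀ hp]
        have h3 : r ^ (2 * s) * fracOp n s (dd n e u) (x₀ + r • y) ≤ 1 * Lf :=
          mul_le_mul hr2 h1 (abs_nonneg _) zero_le_one |>.trans' <|
            mul_le_mul_of_nonneg_left (le_abs_self _) hr20
        linarith
      · rw [hU, fracOp_const_mul_comp hs hu _ hr0, h2, mul_assoc, neg_le, ← mul_neg,
          inv_mul_le_iff₀ hrp0]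
        have h3 := mul_le_mul_of_nonneg_left (hflow _ hz) hr20
        have h4 : r ^ (2 * s) * (K * M + 2 * Lf) ≤ 1 * (K * M + 2 * Lf) :=
          mul_le_mul_of_nonneg_right hr2 (by positivity)
        have h5 : K * M ≤ K * S := mul_le_mul_of_nonneg_left (by linarith) hK.le
        linarith
  · rw [hdU]
    simp [← hpdef, hp.ne']

lemma exists_dd_dd_le (hn : 0 < n) :
    ∃ C : ℝ, 0 < C ∧ ∀ s ∈ Icc (0:ℝ) 1, ∀ (e : En n) (f g u : En n → ℝ) (M Lf Qf Qg : ℝ),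
      ‖e‖ = 1 → ObstacleSolution n s e f g u M → 0 ≤ Lf → 0 ≤ Qf → 0 ≤ Qg →
      (∀ x ∈ ball (0 : En n) 1, ∀ h : ℝ, x + h • e ∈ ball (0 : En n) 1 →
        |f (x + h • e) - f x| ≤ Lf * |h|) →
      (∀ x ∈ ball (0 : En n) 1, ∀ h : ℝ,
        x + h • e ∈ ball (0 : En n) 1 → x - h • e ∈ ball (0 : En n) 1 →
        f (x + h • e) + f (x - h • e) - 2 * f x ≤ Qf * h ^ 2) →
      (∀ x ∈ ball (0 : En n) 1, ∀ h : ℝ,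
        x + h • e ∈ ball (0 : En n) 1 → x - h • e ∈ ball (0 : En n) 1 →
        g (x + h • e) + g (x - h • e) - 2 * g x ≤ Qg * h ^ 2) →
      ∀ x ∈ ball (0 : En n) (1 / 2), dd n e (dd n e u) x ≤ C * (M + Lf + Qf + Qg) := by
  obtain ⟨ε, ⟨hε0, hε1⟩, hcore⟩ := exists_fracOp_threshold_second hn
  have hC : 0 < 1024 / ε ^ 3 := by positivity
  refine ⟨1024 / ε ^ 3, hC, fun s hs e f g u M Lf Qf Qg he h hLf hQf hQg hf hf2 hg2 x hx => ?_⟩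
  by_contra! hlt
  have hM := h.nonneg
  have hu := h.smooth
  have hV := contDiff_dd hu e
  set S := M + Lf + Qf + Qg with hS
  have hS0 : 0 ≤ S := by positivity
  obtain ⟨x₀, r, hr0, hr1, hp, hrp, hpt⟩ := exists_almost_max (contDiff_dd hV e).continuous
    two_ne_zero (κ := ε / 4) ⟨by positivity, by linarith⟩ hε0.le (by nlinarith [pow_pos hε0 3]) hx
    (lt_of_le_of_lt (by positivity) hlt)
  set p := dd n e (dd n e u) x₀ with hpdef
  have hbig : S ≤ ε * (r ^ 2 * p) := by
    have h1 : (ε / 4 / 8) ^ 2 * (1024 / ε ^ 3 * S) ≤ r ^ 2 * p :=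
      (mul_le_mul_of_nonneg_left hlt.le (by positivity)).trans hrp
    have h2 := mul_le_mul_of_nonneg_left h1 hε0.le
    refine le_trans (le_of_eq ?_) h2
    field_simp
    ring
  have hrp0 : 0 < r * p := by positivity
  have hrrp0 : 0 < r ^ 2 * p := by positivity
  have hrp1 : ε * (r ^ 2 * p) ≤ ε * (r * p) :=
    mul_le_mul_of_nonneg_left (by nlinarith) hε0.le
  have hrp2 : ε * (r * p) ≤ ε * p := mul_le_mul_of_nonneg_left (by nlinarith) hε0.le
  have hr2 : r ^ (2 * s) ≤ 1 := Real.rpow_le_one hr0.le hr1 (by linarith [hs.1])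
  have hr20 : 0 ≤ r ^ (2 * s) := Real.rpow_nonneg hr0.le _
  set U : En n → ℝ := fun y => (r ^ 2 * p)⁻¹ * u (x₀ + r • y) with hU
  have hdU : dd n e U = fun y => (r * p)⁻¹ * dd n e u (x₀ + r • y) := by
    funext y
    rw [hU, dd_const_mul_comp hu]
    field_simp
  have hddU : dd n e (dd n e U) = fun y => p⁻¹ * dd n e (dd n e u) (x₀ + r • y) := by
    rw [hdU]
    funext y
    rw [dd_const_mul_comp hV]
    field_simp
  obtain ⟨M₁, hM₁⟩ := h.dd_bdd
  obtain ⟨M₂, hM₂⟩ := h.dd2_bdd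
  refine hcore s hs U e (contDiff_const_mul_comp hu _ _ _) he ⟨|(r * p)⁻¹| * M₁, fun y => ?_⟩
    ⟨|p⁻¹| * M₂, fun y => ?_⟩ (fun y => ?_) (fun y hy => ?_) (fun y hy => ?_) ?_
  · rw [hdU, abs_mul]
    exact mul_le_mul_of_nonneg_left (hM₁ _) (abs_nonneg _)
  · rw [hddU, abs_mul]
    exact mul_le_mul_of_nonneg_left (hM₂ _) (abs_nonneg _)
  · rw [hU, abs_mul, abs_of_pos (inv_pos.2 hrrp0), inv_mul_le_iff₀ hrrp0]
    linarith [h.abs_le (x₀ + r • y)]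
  · simp only [hddU]
    rw [inv_mul_le_iff₀ hp]
    linarith [(hpt y hy).2]
  · have hz := (hpt y (closedBall_subset_closedBall (by norm_num) hy)).1
    rw [hddU, hdU]
    refine (h.dd_dd_dichotomy hn hs hf hf2 hg2 hz).imp (fun h1 => ?_) fun ⟨h1, h2⟩ => ?_
    · simp only
      rw [inv_mul_le_iff₀ hp]
      linarith
    · constructor
      · rw [fracOp_const_mul_comp hs (contDiff_dd hV e) _ hr0, mul_assoc, inv_mul_le_iff₀ hp]
        have h3 := mul_le_mul_of_nonneg_left h1 hr20
        have h4 := mul_le_mul_of_nonneg_right hr2 hQf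
        linarith
      · rw [fracOp_const_mul_comp hs hV _ hr0, mul_assoc, abs_mul, abs_mul,
          abs_of_pos (inv_pos.2 hrp0), abs_of_nonneg hr20, inv_mul_le_iff₀ hrp0]
        have h3 := mul_le_mul_of_nonneg_left h2 hr20
        have h4 := mul_le_mul_of_nonneg_right hr2 hLf
        linarith
  · rw [hddU]
    simp [← hpdef, hp.ne']

end estimates

/-- gradient and semiconcavity estimates for the fractional obstacle
problem `max{ (-Δ)^s u , u − g } = f` in `B₁`, `s ∈ [0,1]`, with a constant `C`
depending only on `n`. -/
theorem fractional_obstacle_problem_estimates (n : ℕ) (hn : 0 < n) :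
    ∃ C : ℝ, 0 < C ∧
    ∀ (s : ℝ), s ∈ Set.Icc (0:ℝ) 1 →
    ∀ (f g u : En n → ℝ),
      -- `f` and `g` Lipschitz in `B₁`
      (∃ Lf : NNReal, LipschitzOnWith Lf f (ball (0 : En n) 1)) →
      (∃ Lg : NNReal, LipschitzOnWith Lg g (ball (0 : En n) 1)) →
      ContDiff ℝ (⊤ : ℕ∞) u →
      (∃ Mu : ℝ, ∀ x, |u x| ≤ Mu ∧ ‖fderiv ℝ u x‖ ≤ Mu ∧ ‖fderiv ℝ (fderiv ℝ u) x‖ ≤ Mu) →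
      -- the equation `max{ (-Δ)^s u, u − g } = f` everywhere in `B₁`
      (∀ x ∈ ball (0 : En n) 1, max (fracLapE n s u x) (u x - g x) = f x) →
    ∀ (Minf Lf Lg : ℝ),
      (∀ x : En n, |u x| ≤ Minf) →
      0 ≤ Lf → (∀ x ∈ ball (0 : En n) 1, ∀ y ∈ ball (0 : En n) 1,
        |f x - f y| ≤ Lf * dist x y) →
      0 ≤ Lg → (∀ x ∈ ball (0 : En n) 1, ∀ y ∈ ball (0 : En n) 1,
        |g x - g y| ≤ Lg * dist x y) →
      -- gradient estimate
      ((∀ x ∈ ball (0 : En n) (1/2), ‖fderiv ℝ u x‖ ≤ C * (Minf + Lf + Lg))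
      ∧
      -- one-sided second derivative estimate under semiconcavity
      ((∃ c : ℝ, ConcaveOn ℝ (ball (0 : En n) 1) fun x => f x - c * ‖x‖^2) →
       (∃ c : ℝ, ConcaveOn ℝ (ball (0 : En n) 1) fun x => g x - c * ‖x‖^2) →
       ∀ e : En n, ‖e‖ = 1 →
       ∀ (Lef Qef Leg Qeg : ℝ), 0 ≤ Lef → 0 ≤ Qef → 0 ≤ Leg → 0 ≤ Qeg →
       -- `‖∂_e f‖_{L^∞(B₁)} ≤ Lef` and `‖(∂²_e f)₊‖_{L^∞(B₁)} ≤ Qef`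
       (∀ x ∈ ball (0 : En n) 1, ∀ h : ℝ, x + h • e ∈ ball (0 : En n) 1 →
          |f (x + h • e) - f x| ≤ Lef * |h|) →
       (∀ x ∈ ball (0 : En n) 1, ∀ h : ℝ,
          x + h • e ∈ ball (0 : En n) 1 → x - h • e ∈ ball (0 : En n) 1 →
          f (x + h • e) + f (x - h • e) - 2 * f x ≤ Qef * h^2) →
       -- `‖∂_e g‖_{L^∞(B₁)} ≤ Leg` and `‖(∂²_e g)₊‖_{L^∞(B₁)} ≤ Qeg`
       (∀ x ∈ ball (0 : En n) 1, ∀ h : ℝ, x + h • e ∈ ball (0 : En n) 1 →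
          |g (x + h • e) - g x| ≤ Leg * |h|) →
       (∀ x ∈ ball (0 : En n) 1, ∀ h : ℝ,
          x + h • e ∈ ball (0 : En n) 1 → x - h • e ∈ ball (0 : En n) 1 →
          g (x + h • e) + g (x - h • e) - 2 * g x ≤ Qeg * h^2) →
       ∀ x ∈ ball (0 : En n) (1/2),
         dd2 n e u x ≤ C * (Minf + Lef + Qef + Leg + Qeg))) := by
  obtain ⟨C₁, hC₁, h₁⟩ := exists_dd_le hn
  obtain ⟨C₂, hC₂, h₂⟩ := exists_dd_dd_le hn
  refine ⟨C₁ + C₂, by positivity, ?_⟩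
  rintro s hs f g u - - hu ⟨Mu, hMu⟩ heq Minf Lf Lg hM hLf hf hLg hg
  have hM0 : 0 ≤ Minf := (abs_nonneg _).trans (hM 0)
  have hsol : ∀ e : En n, ‖e‖ = 1 → ObstacleSolution n s e f g u Minf := fun e he =>
    { smooth := hu
      abs_le := hM
      dd_bdd := ⟨Mu, abs_dd_le_of_fderiv (fun x => (hMu x).2.1) he⟩
      dd2_bdd := ⟨Mu, abs_dd2_le_of_fderiv hu (fun x => (hMu x).2.2) he⟩
      le_force := fun x hx => by
        rw [← fracLapE_eq_fracOp hn hs hu ⟨Minf, hM⟩, ← heq x hx]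
        exact le_max_left _ _
      le_obstacle := fun x hx => by
        linarith [heq x hx, le_max_right (fracLapE n s u x) (u x - g x)]
      eq_or_eq := fun x hx => by
        rw [← fracLapE_eq_fracOp hn hs hu ⟨Minf, hM⟩]
        rcases max_choice (fracLapE n s u x) (u x - g x) with h | h
        · exact .inl (h ▸ heq x hx)
        · refine .inr ?_
          have := heq x hx
          rw [h] at this
          linarith }
  refine ⟨fun x hx => ?_, fun _ _ e he Lef Qef Leg Qeg hLef hQef hLeg hQeg hf1 hf2 _ hg2 x hx => ?_⟩
  · have hdd : ∀ e : En n, ‖e‖ = 1 → fderiv ℝ u x e ≤ C₁ * (Minf + Lf + Lg) := fun e he =>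
      h₁ s hs e f g u Minf Lf Lg he (hsol e he) hLf hLg hf hg x hx
    have h3 : ‖fderiv ℝ u x‖ ≤ C₁ * (Minf + Lf + Lg) := by
      refine ContinuousLinearMap.opNorm_le_of_unit_norm (by positivity) fun e he => ?_
      have := hdd (-e) (by rwa [norm_neg])
      rw [map_neg] at this
      exact abs_le.2 ⟨by linarith, hdd e he⟩
    refine h3.trans (mul_le_mul_of_nonneg_right (by linarith) (by positivity))
  · refine (h₂ s hs e f g u Minf Lef Qef Qeg he (hsol e he) hLef hQef hQeg
      hf1 hf2 hg2 x hx).trans ?_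
    exact mul_le_mul (by linarith) (by linarith) (by positivity) (by positivity)
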